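/- arXiv:2104.05206 — 3 statements merged into one kernel-verified Lean document; each statement's English description precedes it below -/
import Mathlib

section
/- Let K ⊂ ℝ² be a compact convex set with nonempty interior whose boundary is a C² curve with curvature κ(t) satisfying |κ(t)| ≤ 1/r for all t (r > 0). Then for every boundary point p ∈ ∂K there exists a closed disk of radius r contained in K that is tangent to ∂K at p (i.e., p lies on the boundary of the disk). -/
theorem roll_seg {E : Type*} [NormedAddCommGroup E] [InnerProductSpace ℝ E] (K : Set E)
    (hK : IsClosed K) (x z : E) (hx : x ∈ interior K) (hz : z ∉ K) :
    ∃ y, y ∈ segment ℝ x z ∧ y ∈ frontier K := by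
  by_contra hcon
  push Not at hcon
  obtain ⟨y, -, hy1, hy2⟩ := (convex_segment (𝕜 := ℝ) x z).isPreconnected (interior K) Kᶜ
    isOpen_interior hK.isOpen_compl (by
      intro y hy
      by_cases h : y ∈ K
      · left
        by_contra h'
        exact hcon y hy ⟨subset_closure h, h'⟩
      · exact Or.inr h) ⟨x, left_mem_segment ℝ _ _, hx⟩ ⟨z, right_mem_segment ℝ _ _, hz⟩
  exact hy2 (interior_subset hy1)

open Set in
/-- Between consecutive points of `{G = 0} ∪ {G = w}`, `F` is nonnegative. -/
theorem rolling_core (F G F' G' k : ℝ → ℝ) (w : ℝ)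
    (hw : 0 < w)
    (hG : ∀ t, HasDerivAt G (G' t) t) (hF : ∀ t, HasDerivAt F (F' t) t)
    (hk : ∀ t, 0 ≤ k t) (hFG : ∀ t, F' t = k t * G' t)
    (hcrit : ∀ t, G' t = 0 → G t = 0 ∨ G t = w)
    (hF0 : ∀ t, G t = 0 → F t = 0)
    (α β : ℝ) (hαβ : α < β) (hα : G α = 0 ∨ G α = w) (hβ : G β = 0 ∨ G β = w)
    (hbt : ∀ t ∈ Ioo α β, G t ≠ 0 ∧ G t ≠ w) :
    ∀ t ∈ Icc α β, 0 ≤ F t := by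
  have hne : ∀ t ∈ Ioo α β, G' t ≠ 0 := by
    intro t ht h0
    rcases hcrit t h0 with h | h
    · exact (hbt t ht).1 h
    · exact (hbt t ht).2 h
  have hGc : Continuous G := continuous_iff_continuousAt.2 fun t => (hG t).continuousAt
  have hFc : Continuous F := continuous_iff_continuousAt.2 fun t => (hF t).continuousAt
  have hGd : ∀ t, deriv G t = G' t := fun t => (hG t).deriv
  have hFd : ∀ t, deriv F t = F' t := fun t => (hF t).deriv
  have hFdiff : DifferentiableOn ℝ F (interior (Icc α β)) :=
    fun t _ => (hF t).differentiableAt.differentiableWithinAt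
  rcases hasDerivWithinAt_forall_lt_or_forall_gt_of_forall_ne (convex_Ioo α β)
    (fun t _ => (hG t).hasDerivWithinAt) hne with hs | hs
  · have hlt : StrictAntiOn G (Icc α β) :=
      strictAntiOn_of_deriv_neg (convex_Icc _ _) hGc.continuousOn (by
        intro t ht; rw [interior_Icc] at ht; rw [hGd]; exact hs t ht)
    have h1 := hlt (left_mem_Icc.2 hαβ.le) (right_mem_Icc.2 hαβ.le) hαβ
    have hb0 : G β = 0 := by
      rcases hα with h | h <;> rcases hβ with h' | h' <;> first | exact h' | (exfalso; linarith)
    have hm : AntitoneOn F (Icc α β) :=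
      antitoneOn_of_deriv_nonpos (convex_Icc _ _) hFc.continuousOn hFdiff (by
        intro t ht; rw [interior_Icc] at ht; rw [hFd, hFG]
        exact mul_nonpos_of_nonneg_of_nonpos (hk t) (hs t ht).le)
    intro t ht
    have := hm ht (right_mem_Icc.2 hαβ.le) ht.2
    rw [hF0 β hb0] at this; exact this
  · have hlt : StrictMonoOn G (Icc α β) :=
      strictMonoOn_of_deriv_pos (convex_Icc _ _) hGc.continuousOn (by
        intro t ht; rw [interior_Icc] at ht; rw [hGd]; exact hs t ht)
    have h1 := hlt (left_mem_Icc.2 hαβ.le) (right_mem_Icc.2 hαβ.le) hαβ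
    have hb0 : G α = 0 := by
      rcases hα with h | h <;> rcases hβ with h' | h' <;> first | exact h | (exfalso; linarith)
    have hm : MonotoneOn F (Icc α β) :=
      monotoneOn_of_deriv_nonneg (convex_Icc _ _) hFc.continuousOn hFdiff (by
        intro t ht; rw [interior_Icc] at ht; rw [hFd, hFG]
        exact mul_nonneg (hk t) (hs t ht).le)
    intro t ht
    have := hm (left_mem_Icc.2 hαβ.le) ht ht.1
    rw [hF0 α hb0] at this; exact this

open Set in
theorem rolling_analytic (F G F' G' k : ℝ → ℝ) (w C L s : ℝ)
    (hw : 0 < w) (hL : 0 < L) (hper : Function.Periodic G L) (hs : G s = 0)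
    (hG : ∀ t, HasDerivAt G (G' t) t) (hF : ∀ t, HasDerivAt F (F' t) t)
    (hk : ∀ t, 0 ≤ k t) (hFG : ∀ t, F' t = k t * G' t)
    (hcrit : ∀ t, G' t = 0 → G t = 0 ∨ G t = w)
    (hF0 : ∀ t, G t = 0 → F t = 0) (hFw : ∀ t, G t = w → F t = C) :
    ∀ t, 0 ≤ F t := by
  intro t
  have hGc : Continuous G := continuous_iff_continuousAt.2 fun t => (hG t).continuousAt
  have hZ : ∀ c, IsClosed {x | G x = c} := fun c => isClosed_eq hGc continuous_const
  -- zeros on both sides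
  have hz1 : ∃ x < t, G x = 0 := by
    obtain ⟨n, hn⟩ := exists_nat_gt ((s - t) / L)
    refine ⟨s - n * L, ?_, ?_⟩
    · rw [div_lt_iff₀ hL] at hn; linarith
    · rw [hper.sub_nat_mul_eq]; exact hs
  have hz2 : ∃ x > t, G x = 0 := by
    obtain ⟨n, hn⟩ := exists_nat_gt ((t - s) / L)
    refine ⟨s + n * L, ?_, ?_⟩
    · rw [div_lt_iff₀ hL] at hn; show t < _; linarith
    · have := (hper.nat_mul n) s
      rw [this]; exact hs
  obtain ⟨x, hx, hGx⟩ := hz1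
  obtain ⟨y, hy, hGy⟩ := hz2
  by_cases h0 : G t = 0
  · exact (hF0 t h0).ge
  by_cases h1 : G t = w
  · obtain ⟨α, ⟨hα, hα'⟩, hαm⟩ := (isCompact_Icc.inter_right (hZ 0) :
      IsCompact (Icc x t ∩ {x | G x = 0})).exists_isGreatest ⟨x, ⟨le_rfl, hx.le⟩, hGx⟩
    have hαt : α < t := lt_of_le_of_ne hα.2 (fun h => h0 (h ▸ hα'))
    obtain ⟨β, ⟨hβ, hβ'⟩, hβm⟩ := (isCompact_Icc.inter_right (hZ w) :
      IsCompact (Icc α t ∩ {x | G x = w})).exists_isLeast ⟨t, ⟨hαt.le, le_rfl⟩, h1⟩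
    simp only [mem_ofPred_eq] at hα' hβ'
    have hαβ : α < β := lt_of_le_of_ne hβ.1 (fun h => by rw [h] at hα'; linarith)
    have := rolling_core F G F' G' k w hw hG hF hk hFG hcrit hF0 α β hαβ (Or.inl hα')
      (Or.inr hβ') (fun z hz => ⟨fun h => by
        have := hαm ⟨⟨hα.1.trans hz.1.le, hz.2.le.trans hβ.2⟩, h⟩
        linarith [hz.1], fun h => by
        have := hβm ⟨⟨hz.1.le, hz.2.le.trans hβ.2⟩, h⟩
        linarith [hz.2]⟩) β (right_mem_Icc.2 hαβ.le)
    rw [hFw β hβ'] at this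
    rw [hFw t h1]; exact this
  · have hS : IsClosed ({x | G x = 0} ∪ {x | G x = w}) := (hZ 0).union (hZ w)
    obtain ⟨α, ⟨hα, hα'⟩, hαm⟩ := (isCompact_Icc.inter_right hS :
      IsCompact (Icc x t ∩ _)).exists_isGreatest ⟨x, ⟨le_rfl, hx.le⟩, Or.inl hGx⟩
    obtain ⟨β, ⟨hβ, hβ'⟩, hβm⟩ := (isCompact_Icc.inter_right hS :
      IsCompact (Icc t y ∩ _)).exists_isLeast ⟨y, ⟨le_of_lt hy, le_rfl⟩, Or.inl hGy⟩
    simp only [mem_union, mem_ofPred_eq] at hα' hβ'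
    have hαt : α < t := lt_of_le_of_ne hα.2 (fun h => by subst h; tauto)
    have hβt : t < β := lt_of_le_of_ne hβ.1 (fun h => by subst h; tauto)
    have key : ∀ z ∈ Ioo α β, ¬ (G z = 0 ∨ G z = w) := by
      intro z hz h
      rcases le_total z t with h' | h'
      · have := hαm ⟨⟨hα.1.trans hz.1.le, h'⟩, h⟩
        linarith [hz.1]
      · have := hβm ⟨⟨h', hz.2.le.trans hβ.2⟩, h⟩
        linarith [hz.2]
    exact rolling_core F G F' G' k w hw hG hF hk hFG hcrit hF0 α β (hαt.trans hβt) hα' hβ'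
      (fun z hz => not_or.1 (key z hz)) t ⟨hαt.le, hβt.le⟩

open Set in
theorem rolling_abstract {E : Type*} [NormedAddCommGroup E] [InnerProductSpace ℝ E]
    (r L : ℝ) (hr : 0 < r) (hL : 0 < L) (K : Set E)
    (hK : IsCompact K) (x₀ : E)
    (σ v a : ℝ → E) (J : E →L[ℝ] E)
    (hJJ : ∀ x, J (J x) = -x) (hJn : ∀ x y, inner ℝ (J x) (J y) = inner ℝ x y)
    (hspan : ∀ v n, ‖v‖ = 1 → inner ℝ v n = 0 → n = inner ℝ n (J v) • J v)
    (hper : Function.Periodic σ L)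
    (hderiv : ∀ t, HasDerivAt σ (v t) t)
    (hderiv2 : ∀ t, HasDerivAt v (a t) t)
    (hunit : ∀ t, ‖v t‖ = 1)
    (hcurv : ∀ t, ‖a t‖ ≤ 1 / r)
    (hbdry : range σ = frontier K) (hx₀ : x₀ ∈ interior K)
    (hstrict : ∀ t, inner ℝ (x₀ - σ t) (J (v t)) < 0)
    (hsupp : ∀ t, ∀ x ∈ K, inner ℝ (x - σ t) (J (v t)) ≤ 0) :
    ∀ p ∈ frontier K, ∃ c : E, dist p c = r ∧ Metric.closedBall c r ⊆ K := by
  have hσK : ∀ t, σ t ∈ K := fun t => hK.isClosed.frontier_subset (hbdry ▸ mem_range_self t)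
  have hJv : ∀ t, ‖J (v t)‖ = 1 := by
    intro t
    have := hJn (v t) (v t)
    rw [real_inner_self_eq_norm_sq, real_inner_self_eq_norm_sq, hunit] at this
    nlinarith [norm_nonneg (J (v t))]
  have hJJ1 : ∀ t, inner ℝ (J (v t)) (J (v t)) = 1 := by
    intro t; rw [real_inner_self_eq_norm_sq, hJv]; norm_num
  -- acceleration is normal
  have hva : ∀ t, inner ℝ (v t) (a t) = 0 := by
    intro t
    have h1 := (hderiv2 t).inner ℝ (hderiv2 t)
    have h2 : (fun t => inner ℝ (v t) (v t)) = fun _ => (1:ℝ) := by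
      funext t; rw [real_inner_self_eq_norm_sq, hunit]; norm_num
    rw [h2] at h1
    have h3 := h1.unique (hasDerivAt_const t (1:ℝ))
    rw [real_inner_comm (v t) (a t)] at h3
    linarith
  have main : ∀ s t, r * (1 - inner ℝ (J (v t)) (J (v s))) ≤
      inner ℝ (σ s - σ t) (J (v s)) := by
    intro s
    set U := J (v s) with hU
    let lam : ℝ → ℝ := fun t => inner ℝ (a t) (J (v t))
    have hlam : ∀ t, a t = lam t • J (v t) := fun t => hspan _ _ (hunit t) (hva t)
    have hlam_le : ∀ t, |lam t| ≤ 1 / r := fun t =>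
      (abs_real_inner_le_norm _ _).trans (by rw [hJv, mul_one]; exact hcurv t)
    let G : ℝ → ℝ := fun t => inner ℝ (σ s - σ t) U
    let F : ℝ → ℝ := fun t => G t - r * (1 - inner ℝ (J (v t)) U)
    have hG : ∀ t, HasDerivAt G (-inner ℝ (v t) U) t := by
      intro t
      have := ((hderiv t).const_sub (σ s)).inner ℝ (hasDerivAt_const t U)
      simpa using this
    have hJd : ∀ t, HasDerivAt (fun t => J (v t)) (-(lam t) • v t) t := by
      intro t
      have := J.hasFDerivAt.comp_hasDerivAt t (hderiv2 t)
      have e : J (a t) = -(lam t) • v t := by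
        conv_lhs => rw [hlam t]
        rw [map_smul, hJJ]; simp
      rw [e] at this; exact this
    have hF : ∀ t, HasDerivAt F ((1 + r * lam t) * (-inner ℝ (v t) U)) t := by
      intro t
      have := (hG t).sub ((((hJd t).inner ℝ (hasDerivAt_const t U)).const_sub 1).const_mul r)
      refine this.congr_deriv ?_
      simp [inner_smul_left]
      ring
    have hGdich : ∀ t, inner ℝ (v t) U = 0 → J (v t) = U ∨ J (v t) = -U := by
      intro t h
      have h1 := hspan _ _ (hunit t) h
      have h2 : |inner ℝ U (J (v t))| = 1 := by
        have := congrArg norm h1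
        rw [norm_smul, hJv t, mul_one, show ‖U‖ = 1 from hJv s] at this
        rw [← Real.norm_eq_abs]; exact this.symm
      rcases eq_or_eq_neg_of_abs_eq h2 with h3 | h3
      · left; rw [h3, one_smul] at h1; exact h1.symm
      · right; rw [h3] at h1; rw [h1]; simp
    have hGnn : ∀ t, 0 ≤ G t := by
      intro t
      have := hsupp s _ (hσK t)
      have e : G t = - inner ℝ (σ t - σ s) U := by
        show inner ℝ (σ s - σ t) U = _
        rw [← inner_neg_left, neg_sub]
      linarith
    -- a global maximum of G
    have hcontσ : Continuous σ := continuous_iff_continuousAt.2 fun t => (hderiv t).continuousAt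
    have hcpt : IsCompact (range σ) := hbdry ▸ hK.of_isClosed_subset isClosed_frontier
      hK.isClosed.frontier_subset
    obtain ⟨_, ⟨τ, rfl⟩, hτ⟩ := hcpt.exists_isMaxOn (range_nonempty σ)
      (f := fun x => inner ℝ (σ s - x) U) (by fun_prop)
    have hmax : ∀ t, G t ≤ G τ := fun t => hτ (mem_range_self t)
    have hsplit : ∀ t x, inner ℝ (x - σ t) U = inner ℝ (x - σ s) U + G t := by
      intro t x
      show _ = _ + inner ℝ (σ s - σ t) U
      rw [← inner_add_left]; congr 1; abel
    have hpos : ∀ t, J (v t) = -U → G t = G τ ∧ 0 < G t := by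
      intro t h
      have h1 := hsupp t _ (hσK τ)
      have h2 := hstrict t
      have h3 := hstrict s
      rw [h, inner_neg_right, hsplit] at h1 h2
      have h4 : inner ℝ (σ τ - σ s) U = - G τ := by
        show _ = - inner ℝ (σ s - σ τ) U
        rw [← inner_neg_left, neg_sub]
      refine ⟨le_antisymm (hmax t) (by linarith), by linarith⟩
    have hzero : ∀ t, J (v t) = U → G t = 0 := by
      intro t h
      have := hsupp t _ (hσK s)
      rw [h] at this
      exact le_antisymm this (hGnn t)
    have hτc : inner ℝ (v τ) U = 0 := by
      have : IsLocalMax G τ := Filter.Eventually.of_forall hmax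
      have := this.hasDerivAt_eq_zero (hG τ)
      linarith
    have hw : 0 < G τ := by
      rcases (hGnn τ).lt_or_eq with h | h
      · exact h
      exfalso
      have hz : ∀ t, G t = 0 := fun t => le_antisymm ((hmax t).trans h.symm.le) (hGnn t)
      -- every point of K lies in the half plane; a boundary point on the other side
      have hUne : 0 < inner ℝ U U := by rw [hU, hJJ1]; norm_num
      have h3 := hstrict s
      obtain ⟨R, hR⟩ := hK.isBounded.subset_closedBall x₀
      let z := x₀ - (|R| + 1) • U
      have hzK : z ∉ K := by
        intro hz
        have := hR hz
        rw [Metric.mem_closedBall, dist_eq_norm] at this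
        have e : z - x₀ = -((|R| + 1) • U) := by simp [z]
        rw [e, norm_neg, norm_smul, hU, hJv, mul_one, Real.norm_eq_abs,
          abs_of_pos (by positivity)] at this
        linarith [le_abs_self R]
      obtain ⟨y, hy1, hy2⟩ := roll_seg K hK.isClosed x₀ z hx₀ hzK
      rw [← hbdry] at hy2
      obtain ⟨t, rfl⟩ := hy2
      obtain ⟨θ, hθ, hθe⟩ := (segment_eq_image' ℝ x₀ z) ▸ hy1
      have := hz t
      have e : G t = - inner ℝ (x₀ - σ s) U + θ * (|R| + 1) * inner ℝ U U := by
        show inner ℝ (σ s - σ t) U = _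
        rw [← hθe]
        simp only [z, inner_sub_left, inner_add_left, inner_smul_left]
        simp
        ring
      have : 0 ≤ θ * (|R| + 1) * inner ℝ U U :=
        mul_nonneg (mul_nonneg hθ.1 (by positivity)) hUne.le
      linarith
    have hUU : inner ℝ U U = (1:ℝ) := hJJ1 s
    have hfin := rolling_analytic F G _ _ (fun t => 1 + r * lam t) (G τ) (G τ - 2 * r) L s hw hL
      (by intro t; show inner ℝ (σ s - σ (t + L)) U = _; rw [hper t])
      (by simp [G]) hG hF
      (by
        intro t
        have h1 := (abs_le.1 (hlam_le t)).1
        have h2 := mul_le_mul_of_nonneg_left h1 hr.le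
        have h3 : r * -(1 / r) = -1 := by field_simp
        show 0 ≤ 1 + r * lam t
        linarith)
      (fun t => rfl)
      (by
        intro t h
        rcases hGdich t (by linarith) with h | h
        · exact Or.inl (hzero t h)
        · exact Or.inr (hpos t h).1)
      (by
        intro t h
        have hm : IsLocalMin G t := Filter.Eventually.of_forall (fun x => by rw [h]; exact hGnn x)
        have := hm.hasDerivAt_eq_zero (hG t)
        rcases hGdich t (by linarith) with h' | h'
        · simp only [F, h, h', hUU]; ring
        · have := (hpos t h').2; linarith)
      (by
        intro t h
        have hm : IsLocalMax G t := Filter.Eventually.of_forall (fun x => by rw [h]; exact hmax x)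
        have := hm.hasDerivAt_eq_zero (hG t)
        rcases hGdich t (by linarith) with h' | h'
        · have := hzero t h'; linarith
        · simp only [F, h, h', inner_neg_left, hUU]; ring)
    intro t
    have := hfin t
    simp only [F, G] at this
    linarith
  intro p hp
  rw [← hbdry] at hp
  obtain ⟨t, rfl⟩ := hp
  refine ⟨σ t - r • J (v t), ?_, ?_⟩
  · rw [dist_eq_norm, sub_sub_cancel, norm_smul, hJv, mul_one, Real.norm_eq_abs, abs_of_pos hr]
  · intro x hx
    by_contra hxK
    obtain ⟨y, hy1, hy2⟩ := roll_seg K hK.isClosed x₀ x hx₀ hxK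
    have hyK := hK.isClosed.frontier_subset hy2
    rw [← hbdry] at hy2
    obtain ⟨s, rfl⟩ := hy2
    obtain ⟨θ, hθ, hθe⟩ := (segment_eq_image' ℝ x₀ x) ▸ hy1
    have hm := main s t
    have h0 := hstrict s
    have hθ1 : θ < 1 := lt_of_le_of_ne hθ.2 (by
      rintro rfl
      apply hxK
      simp at hθe
      rw [hθe]; exact hyK)
    simp only at hθe
    have e1 : x₀ - σ s = -(θ • (x - x₀)) := by rw [← hθe]; abel
    have e2 : x - σ s = (1 - θ) • (x - x₀) := by rw [← hθe, sub_smul, one_smul]; abel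
    rw [e1, inner_neg_left, inner_smul_left] at h0
    simp at h0
    have h1 : 0 < inner ℝ (x - x₀) (J (v s)) := by
      by_contra hcon
      have := mul_nonpos_of_nonneg_of_nonpos hθ.1 (not_lt.1 hcon)
      linarith
    have h2 : 0 < inner ℝ (x - σ s) (J (v s)) := by
      rw [e2, inner_smul_left]
      exact mul_pos (by simpa using hθ1) h1
    have h3 : inner ℝ (x - (σ t - r • J (v t))) (J (v s)) ≤ r := by
      refine (real_inner_le_norm _ _).trans ?_
      rw [hJv, mul_one, ← dist_eq_norm]; exact hx
    have h4 : inner ℝ (x - (σ t - r • J (v t))) (J (v s)) = inner ℝ (x - σ s) (J (v s))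
        + inner ℝ (σ s - σ t) (J (v s)) + r * inner ℝ (J (v t)) (J (v s)) := by
      simp only [inner_sub_left, inner_smul_left]
      simp
      ring
    linarith

/-- Rotation by a right angle. -/
noncomputable def rollJ : EuclideanSpace ℝ (Fin 2) →L[ℝ] EuclideanSpace ℝ (Fin 2) :=
  LinearMap.toContinuousLinearMap
    { toFun := fun x => !₂[-x 1, x 0]
      map_add' := by
        intro x y; ext i; fin_cases i <;> simp; ring
      map_smul' := by
        intro c x; ext i; fin_cases i <;> simp }

theorem rollJ_zero (x : EuclideanSpace ℝ (Fin 2)) : rollJ x 0 = -x 1 := rfl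
theorem rollJ_one (x : EuclideanSpace ℝ (Fin 2)) : rollJ x 1 = x 0 := rfl

theorem roll_inner (x y : EuclideanSpace ℝ (Fin 2)) :
    inner ℝ x y = x 0 * y 0 + x 1 * y 1 := by
  simp [PiLp.inner_apply, Fin.sum_univ_two, mul_comm]

theorem rollJ_span (v n : EuclideanSpace ℝ (Fin 2)) (hv : ‖v‖ = 1) (h : inner ℝ v n = 0) :
    n = inner ℝ n (rollJ v) • rollJ v := by
  have h1 : inner ℝ v v = 1 := by rw [real_inner_self_eq_norm_sq, hv]; norm_num
  rw [roll_inner] at h h1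
  ext i
  fin_cases i
  · simp [roll_inner, rollJ_zero, rollJ_one]
    linear_combination (-(n 0)) * h1 + v 0 * h
  · simp [roll_inner, rollJ_zero, rollJ_one]
    linear_combination (-(n 1)) * h1 + v 1 * h

/-- **Blaschke rolling disk theorem.** A compact convex planar set with nonempty interior
whose boundary is a `C²` unit-speed curve with curvature `|κ| ≤ 1/r` (encoded by
`‖σ''‖ = ‖a t‖ ≤ 1/r`) admits, at each boundary point `p`, a closed disk of radius `r`
contained in `K` whose boundary circle passes through `p`. -/
theorem blaschke_rolling (r L : ℝ) (hr : 0 < r) (hL : 0 < L)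
    (K : Set (EuclideanSpace ℝ (Fin 2)))
    (hK : IsCompact K) (hconv : Convex ℝ K) (hint : (interior K).Nonempty)
    (σ v a : ℝ → EuclideanSpace ℝ (Fin 2))
    (hper : Function.Periodic σ L) (hvper : Function.Periodic v L)
    (haper : Function.Periodic a L)
    (hderiv : ∀ t, HasDerivAt σ (v t) t)
    (hderiv2 : ∀ t, HasDerivAt v (a t) t)
    (hacont : Continuous a)
    (hunit : ∀ t, ‖v t‖ = 1)
    (hcurv : ∀ t, ‖a t‖ ≤ 1 / r)
    (hinj : Set.InjOn σ (Set.Ico 0 L))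
    (hbdry : σ '' Set.Ico 0 L = frontier K) :
    ∀ p ∈ frontier K, ∃ c : EuclideanSpace ℝ (Fin 2),
      dist p c = r ∧ Metric.closedBall c r ⊆ K := by
  have hrange : Set.range σ = frontier K := by
    refine le_antisymm ?_ (hbdry ▸ Set.image_subset_range _ _)
    rintro _ ⟨t, rfl⟩
    obtain ⟨y, hy, h⟩ := hper.exists_mem_Ico₀ hL t
    rw [h, ← hbdry]; exact Set.mem_image_of_mem σ hy
  obtain ⟨x₀, hx₀⟩ := hint
  have hσf : ∀ t, σ t ∈ frontier K := fun t => hrange ▸ Set.mem_range_self t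
  -- supporting normals
  have hn : ∀ t, ∃ n : EuclideanSpace ℝ (Fin 2), inner ℝ (v t) n = 0 ∧
      inner ℝ (x₀ - σ t) n < 0 ∧ ∀ x ∈ K, inner ℝ (x - σ t) n ≤ 0 := by
    intro t
    obtain ⟨f, hf⟩ := geometric_hahn_banach_open_point hconv.interior isOpen_interior
      (fun h => (hσf t).2 h)
    let n := (InnerProductSpace.toDual ℝ _).symm f
    have hfn : ∀ x, inner ℝ x n = f x := by
      intro x; rw [real_inner_comm]; exact InnerProductSpace.toDual_symm_apply
    have hle : ∀ x ∈ K, inner ℝ (x - σ t) n ≤ 0 := by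
      intro x hx
      have hx' : x ∈ closure (interior K) := by
        rw [hconv.closure_interior_eq_closure_of_nonempty_interior ⟨x₀, hx₀⟩]
        exact subset_closure hx
      have : f x ≤ f (σ t) := by
        refine closure_minimal (s := interior K) (t := {x | f x ≤ f (σ t)})
          (fun y hy => (hf y hy).le) (isClosed_le f.continuous continuous_const) hx'
      rw [hfn, map_sub]; linarith
    refine ⟨n, ?_, ?_, hle⟩
    · have hd := ((hderiv t).sub_const (σ t)).inner ℝ (hasDerivAt_const t n)
      have hm : IsLocalMax (fun τ => inner ℝ (σ τ - σ t) n) t :=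
        Filter.Eventually.of_forall (fun τ => by
          simpa using hle _ (hK.isClosed.frontier_subset (hσf τ)))
      have := hm.hasDerivAt_eq_zero hd
      simpa using this
    · rw [hfn, map_sub]; linarith [hf x₀ hx₀]
  have hcσ : Continuous σ := continuous_iff_continuousAt.2 fun t => (hderiv t).continuousAt
  have hcv : Continuous v := continuous_iff_continuousAt.2 fun t => (hderiv2 t).continuousAt
  let g : ℝ → ℝ := fun t => inner ℝ (x₀ - σ t) (rollJ (v t))
  have hgc : Continuous g := by
    have : Continuous fun t => rollJ (v t) := rollJ.continuous.comp hcv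
    exact (continuous_const.sub hcσ).inner this
  have hg0 : ∀ t, g t ≠ 0 := by
    intro t h
    obtain ⟨n, h1, h2, -⟩ := hn t
    rw [rollJ_span _ _ (hunit t) h1, inner_smul_right] at h2
    simp only [g] at h
    rw [h] at h2
    simp at h2
  have hJJ : ∀ x, rollJ (rollJ x) = -x := by
    intro x; ext i; fin_cases i
    · simp [rollJ_zero, rollJ_one]
    · simp [rollJ_zero, rollJ_one]
  have hJn : ∀ x y, inner ℝ (rollJ x) (rollJ y) = inner ℝ x y := by
    intro x y; simp only [roll_inner, rollJ_zero, rollJ_one]; ring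
  have hsign : (∀ t, g t < 0) ∨ (∀ t, 0 < g t) := by
    by_contra hcon
    push Not at hcon
    obtain ⟨⟨t₁, h1⟩, t₂, h2⟩ := hcon
    obtain ⟨t, ht⟩ := mem_range_of_exists_le_of_exists_ge hgc ⟨t₂, h2⟩ ⟨t₁, h1⟩
    exact hg0 t ht
  have hdecomp : ∀ t, ∃ c : ℝ, c * g t < 0 ∧
      ∀ x ∈ K, c * inner ℝ (x - σ t) (rollJ (v t)) ≤ 0 := by
    intro t
    obtain ⟨n, h1, h2, h3⟩ := hn t
    have e := rollJ_span _ _ (hunit t) h1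
    refine ⟨inner ℝ n (rollJ (v t)), ?_, ?_⟩
    · simp only [g]; rw [← inner_smul_right, ← e]; exact h2
    · intro x hx; rw [← inner_smul_right, ← e]; exact h3 x hx
  rcases hsign with hs | hs
  · refine rolling_abstract r L hr hL K hK x₀ σ v a rollJ hJJ hJn rollJ_span hper hderiv hderiv2
      hunit hcurv hrange hx₀ hs ?_
    intro t x hx
    obtain ⟨c, h1, h2⟩ := hdecomp t
    have hc : 0 < c := by
      by_contra hc
      have := mul_nonneg_of_nonpos_of_nonpos (not_lt.1 hc) (hs t).le
      linarith
    exact nonpos_of_mul_nonpos_right (h2 x hx) hc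
  · refine rolling_abstract r L hr hL K hK x₀ σ v a (-rollJ) (by simp [hJJ]) (by simp [hJn]) ?_
      hper hderiv hderiv2 hunit hcurv hrange hx₀ ?_ ?_
    · intro v n hv h
      have := rollJ_span v n hv h
      simpa using this
    · intro t
      have := hs t
      simp only [g] at this
      simpa using this
    · intro t x hx
      obtain ⟨c, h1, h2⟩ := hdecomp t
      have hc : c < 0 := by
        by_contra hc
        have := mul_nonneg (not_lt.1 hc) (hs t).le
        linarith
      have := nonneg_of_mul_nonpos_right (h2 x hx) hc
      simpa using this
end

section
/- Let r > 0 and let D be the closed disk of radius r internally tangent at a boundary point p to a compact convex set K with C² boundary whose curvature satisfies |κ| ≤ 1/r. Then the intersection ∂D ∩ ∂K is either a single point, a pair of antipodal points of ∂D, or a (connected) circular arc of ∂D; in particular ∂K cannot cross ∂D transversally. -/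
lemma rd_alg (e0 e1 d0 d1 w0 w1 n0 n1 : ℝ) (hed : e0*d0+e1*d1 = 0)
    (hn : n0^2+n1^2 = 1) (hd : 0 < d0^2+d1^2)
    (H1 : 0 ≤ (e0+d0)*(w0+d0) + (e1+d1)*(w1+d1))
    (H2 : 0 ≤ (e0-d0)*(w0-d0) + (e1-d1)*(w1-d1))
    (H3 : 0 ≤ n0*(-d0-w0) + n1*(-d1-w1))
    (H4 : 0 ≤ n0*(d0-w0) + n1*(d1-w1))
    (hw : e0*w0+e1*w1 < 0) : 0 < n0*e0+n1*e1 := by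
  have hee : 0 < e0^2+e1^2 := by
    rcases eq_or_ne e0 0 with h0 | h0
    · rcases eq_or_ne e1 0 with h1 | h1
      · subst h0 h1; simp at hw
      · positivity
    · positivity
  have P1 : 0 < (d0^2+d1^2) + (d0*w0+d1*w1) := by nlinarith
  have P2 : 0 < (d0^2+d1^2) - (d0*w0+d1*w1) := by nlinarith
  have Q1 := mul_nonneg P2.le H3
  have Q2 := mul_nonneg P1.le H4
  have key : (d0^2+d1^2)*(e0^2+e1^2)*(n0*w0+n1*w1) =
      (e0^2+e1^2)*(d0*w0+d1*w1)*(n0*d0+n1*d1) + (d0^2+d1^2)*(e0*w0+e1*w1)*(n0*e0+n1*e1) := by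
    linear_combination ((e0*d0+e1*d1)*(n0*w0+n1*w1) - (d0*w0+d1*w1)*(n0*e0+n1*e1) - (e0*w0+e1*w1)*(n0*d0+n1*d1)) * hed
  have key2 : (e0^2+e1^2) * ((d0^2+d1^2 - (d0*w0+d1*w1)) * (n0*(-d0-w0) + n1*(-d1-w1)) +
     (d0^2+d1^2 + (d0*w0+d1*w1)) * (n0*(d0-w0) + n1*(d1-w1))) =
     2 * (d0^2+d1^2) * (-(e0*w0+e1*w1)) * (n0*e0+n1*e1) := by linear_combination (-2)*key
  have hC : 0 < 2 * (d0^2+d1^2) * (-(e0*w0+e1*w1)) := by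
    have : 0 < -(e0*w0+e1*w1) := by linarith
    positivity
  by_contra hcon
  push Not at hcon
  have hle : 2 * (d0^2+d1^2) * (-(e0*w0+e1*w1)) * (n0*e0+n1*e1) ≤ 0 :=
    mul_nonpos_of_nonneg_of_nonpos hC.le hcon
  have hsum : (d0^2+d1^2 - (d0*w0+d1*w1)) * (n0*(-d0-w0) + n1*(-d1-w1)) +
     (d0^2+d1^2 + (d0*w0+d1*w1)) * (n0*(d0-w0) + n1*(d1-w1)) ≤ 0 := by
    by_contra h
    push Not at h
    have := mul_pos hee h
    linarith
  have z1 : n0*(-d0-w0) + n1*(-d1-w1) = 0 := by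
    have : (d0^2+d1^2 - (d0*w0+d1*w1)) * (n0*(-d0-w0) + n1*(-d1-w1)) = 0 := by linarith
    rcases mul_eq_zero.1 this with h | h
    · linarith
    · exact h
  have z2 : n0*(d0-w0) + n1*(d1-w1) = 0 := by
    have : (d0^2+d1^2 + (d0*w0+d1*w1)) * (n0*(d0-w0) + n1*(d1-w1)) = 0 := by linarith
    rcases mul_eq_zero.1 this with h | h
    · linarith
    · exact h
  have z3 : n0*d0+n1*d1 = 0 := by linarith
  have z4 : n0*e0+n1*e1 = 0 := by
    rw [z1, z2] at key2
    have : 2 * (d0^2+d1^2) * (-(e0*w0+e1*w1)) * (n0*e0+n1*e1) = 0 := by linarith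
    rcases mul_eq_zero.1 this with h | h
    · linarith
    · exact h
  have dn : (d0*e1-d1*e0)^2 = (d0^2+d1^2)*(e0^2+e1^2) := by
    linear_combination (-(e0*d0+e1*d1))*hed
  have hdet : d0*e1-d1*e0 ≠ 0 := by
    intro h
    rw [h] at dn
    have := mul_pos hd hee
    nlinarith
  have a0 : n0 = 0 := by
    have : (d0*e1-d1*e0)*n0 = 0 := by linear_combination e1*z3 - d1*z4
    exact (mul_eq_zero.1 this).resolve_left hdet
  have a1 : n1 = 0 := by
    have : (d0*e1-d1*e0)*n1 = 0 := by linear_combination d0*z4 - e0*z3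
    exact (mul_eq_zero.1 this).resolve_left hdet
  rw [a0, a1] at hn
  norm_num at hn

lemma rd_const (f f' : ℝ → ℝ) (a b : ℝ) (hf : ∀ t, HasDerivAt f (f' t) t)
    (h0 : ∀ t ∈ Set.Ioo a b, 0 ≤ f' t) : MonotoneOn f (Set.Icc a b) := by
  apply monotoneOn_of_deriv_nonneg (convex_Icc a b)
  · exact fun t _ => (hf t).continuousAt.continuousWithinAt
  · exact fun t _ => (hf t).differentiableAt.differentiableWithinAt
  · intro t ht
    rw [interior_Icc] at ht
    rw [(hf t).deriv]; exact h0 t ht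

/-- zero derivative up to the factor: the moving centre is constant along the arc. -/
lemma rd_core (r ε c0 c1 E0 E1 a b : ℝ) (hr : 0 < r) (hε : ε^2 = 1)
    (X Y V W A B : ℝ → ℝ)
    (hX : ∀ t, HasDerivAt X (V t) t) (hY : ∀ t, HasDerivAt Y (W t) t)
    (hV : ∀ t, HasDerivAt V (A t) t) (hW : ∀ t, HasDerivAt W (B t) t)
    (hu : ∀ t, (V t)^2 + (W t)^2 = 1) (hc : ∀ t, (A t)^2 + (B t)^2 ≤ (1/r)^2)
    (hpos : ∀ t ∈ Set.Ioo a b, 0 < ε * (-(W t) * E0 + V t * E1))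
    (qa0 : X a - r*ε*W a = c0) (qa1 : Y a + r*ε*V a = c1)
    (qb0 : X b - r*ε*W b = c0) (qb1 : Y b + r*ε*V b = c1) :
    ∀ t ∈ Set.Icc a b, X t - r*ε*W t = c0 ∧ Y t + r*ε*V t = c1 := by
  have hperp : ∀ t, V t * A t + W t * B t = 0 := by
    intro t
    have h1 := ((hV t).fun_pow 2).fun_add ((hW t).fun_pow 2)
    have h2 : HasDerivAt (fun t => V t ^2 + W t^2) 0 t := by
      simp only [hu]; exact hasDerivAt_const _ _
    have := h1.unique h2
    norm_num at this
    linarith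
  set l : ℝ → ℝ := fun t => 1 - r*ε*(V t * B t - W t * A t) with hl
  have hlnn : ∀ t, 0 ≤ l t := by
    intro t
    have e1 : (V t * B t - W t * A t)^2 ≤ (1/r)^2 := by
      have := hc t
      have h2 : (V t * B t - W t * A t)^2 = (A t)^2 + (B t)^2 := by
        linear_combination (A t^2+B t^2) * hu t - (V t * A t + W t * B t) * hperp t
      linarith
    have e2 : (r*ε*(V t * B t - W t * A t))^2 ≤ 1 := by
      have : (r*ε*(V t * B t - W t * A t))^2 = r^2 * (V t * B t - W t * A t)^2 := by
        rw [mul_pow, mul_pow, hε]; ring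
      rw [this]
      calc _ ≤ r^2 * (1/r)^2 := by gcongr
        _ = 1 := by field_simp
    have := abs_le_of_sq_le_sq' (a := r*ε*(V t * B t - W t * A t)) (b := 1) (by simpa using e2) (by norm_num)
    simp only [hl]; linarith [this.2]
  have d0 : ∀ t, HasDerivAt (fun t => X t - r*ε*W t) (l t * V t) t := by
    intro t
    refine ((hX t).fun_sub ((hW t).const_mul (r*ε))).congr_deriv ?_
    simp only [hl]
    linear_combination (r*ε*B t) * hu t - (r*ε*W t) * hperp t
  have d1 : ∀ t, HasDerivAt (fun t => Y t + r*ε*V t) (l t * W t) t := by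
    intro t
    refine ((hY t).fun_add ((hV t).const_mul (r*ε))).congr_deriv ?_
    simp only [hl]
    linear_combination (-r*ε*A t) * hu t + (r*ε*V t) * hperp t
  set G : ℝ → ℝ := fun t => ε * (-(Y t + r*ε*V t) * E0 + (X t - r*ε*W t) * E1) with hG
  have dG : ∀ t, HasDerivAt G (l t * (ε * (-(W t) * E0 + V t * E1))) t := by
    intro t
    refine (((((d1 t).fun_neg).mul_const E0).fun_add ((d0 t).mul_const E1)).const_mul ε).congr_deriv ?_
    ring
  have mG := rd_const G _ a b dG (fun t ht => mul_nonneg (hlnn t) (hpos t ht).le)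
  have hGa : ∀ t ∈ Set.Icc a b, G t = G a := by
    intro t ht
    have hab := ht.1.trans ht.2
    have h1 := mG (Set.left_mem_Icc.2 hab) ht ht.1
    have h2 := mG ht (Set.right_mem_Icc.2 hab) ht.2
    have h3 : G a = G b := by simp only [hG, qa0, qa1, qb0, qb1]
    linarith
  have hl0 : ∀ t ∈ Set.Ioo a b, l t = 0 := by
    intro t ht
    have h1 : HasDerivAt G 0 t := by
      apply (hasDerivAt_const t (G a)).congr_of_eventuallyEq
      filter_upwards [Ioo_mem_nhds ht.1 ht.2] with s hs
      exact hGa s ⟨hs.1.le, hs.2.le⟩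
    have := (dG t).unique h1
    exact (mul_eq_zero.1 this).resolve_right (hpos t ht).ne'
  have cst : ∀ (f f' : ℝ → ℝ), (∀ t, HasDerivAt f (f' t) t) → (∀ t ∈ Set.Ioo a b, f' t = 0) →
      ∀ t ∈ Set.Icc a b, f t = f a := by
    intro f f' hf h0 t ht
    have hab := ht.1.trans ht.2
    have m1 := rd_const f _ a b hf (fun t ht => (h0 t ht).ge)
    have m2 := rd_const (fun t => - f t) _ a b (fun t => (hf t).fun_neg)
      (fun t ht => by rw [h0 t ht]; simp)
    have h1 := m1 (Set.left_mem_Icc.2 hab) ht ht.1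
    have h2 := m2 (Set.left_mem_Icc.2 hab) ht ht.1
    simp only at h2
    linarith
  intro t ht
  have k0 := cst _ _ d0 (fun t ht => by rw [hl0 t ht]; ring) t ht
  have k1 := cst _ _ d1 (fun t ht => by rw [hl0 t ht]; ring) t ht
  exact ⟨k0.trans qa0, k1.trans qa1⟩

/-- Points of the chord line that lie outside the disk and in both half planes are end points. -/
lemma rd_line (r c0 c1 x0 x1 y0 y1 z0 z1 : ℝ)
    (hx : (c0-x0)^2+(c1-x1)^2 = r^2) (hy : (c0-y0)^2+(c1-y1)^2 = r^2)
    (hz : r^2 ≤ (c0-z0)^2+(c1-z1)^2)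
    (hxy : 0 < (y0-x0)^2+(y1-x1)^2)
    (he : 0 < (c0-(x0+y0)/2)^2+(c1-(x1+y1)/2)^2)
    (Hx : 0 ≤ (c0-x0)*(z0-x0)+(c1-x1)*(z1-x1))
    (Hy : 0 ≤ (c0-y0)*(z0-y0)+(c1-y1)*(z1-y1))
    (h0 : (c0-(x0+y0)/2)*(z0-x0)+(c1-(x1+y1)/2)*(z1-x1) = 0) :
    (z0 = x0 ∧ z1 = x1) ∨ (z0 = y0 ∧ z1 = y1) := by
  obtain ⟨e0, he0⟩ : ∃ e0, e0 = c0-(x0+y0)/2 := ⟨_, rfl⟩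
  obtain ⟨e1, he1⟩ : ∃ e1, e1 = c1-(x1+y1)/2 := ⟨_, rfl⟩
  obtain ⟨d0, hd0⟩ : ∃ d0, d0 = y0-x0 := ⟨_, rfl⟩
  obtain ⟨d1, hd1⟩ : ∃ d1, d1 = y1-x1 := ⟨_, rfl⟩
  obtain ⟨w0, hw0⟩ : ∃ w0, w0 = z0-x0 := ⟨_, rfl⟩
  obtain ⟨w1, hw1⟩ : ∃ w1, w1 = z1-x1 := ⟨_, rfl⟩
  have hed : e0*d0+e1*d1 = 0 := by subst_vars; linear_combination hx/2 - hy/2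
  rw [← he0, ← he1, ← hw0, ← hw1] at h0
  rw [← hd0, ← hd1] at hxy
  rw [← he0, ← he1] at he
  -- w is parallel to d
  have hcr : w0*d1 - w1*d0 = 0 := by
    have h1 : (e0^2+e1^2) * (w0*d1-w1*d0) = 0 := by
      linear_combination (e0*d1-e1*d0)*h0 + (e1*w0-e0*w1)*hed
    exact (mul_eq_zero.1 h1).resolve_left he.ne'
  obtain ⟨s, hs⟩ : ∃ s, s = (w0*d0+w1*d1)/(d0^2+d1^2) := ⟨_, rfl⟩
  have hs' : s*(d0^2+d1^2) = w0*d0+w1*d1 := by rw [hs]; field_simp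
  have hw0' : w0 = s*d0 := by
    have : (d0^2+d1^2)*(w0 - s*d0) = 0 := by linear_combination d1*hcr - d0*hs'
    linarith [(mul_eq_zero.1 this).resolve_left hxy.ne']
  have hw1' : w1 = s*d1 := by
    have : (d0^2+d1^2)*(w1 - s*d1) = 0 := by linear_combination (-d0)*hcr - d1*hs'
    linarith [(mul_eq_zero.1 this).resolve_left hxy.ne']
  have c0' : c0 = e0 + x0 + d0/2 := by rw [he0, hd0]; ring
  have c1' : c1 = e1 + x1 + d1/2 := by rw [he1, hd1]; ring
  have z0' : z0 = x0 + s*d0 := by linarith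
  have z1' : z1 = x1 + s*d1 := by linarith
  have y0' : y0 = x0 + d0 := by linarith
  have y1' : y1 = x1 + d1 := by linarith
  clear he0 he1 hd0 hd1 hw0 hw1
  subst c0' c1' z0' z1' y0' y1'
  have s0 : 0 ≤ s := by
    have : 0 ≤ s*(d0^2+d1^2) := by linear_combination 2*Hx + 2*s*hed
    exact nonneg_of_mul_nonneg_left this hxy
  have s1 : s ≤ 1 := by
    have : 0 ≤ (1-s)*(d0^2+d1^2) := by linear_combination 2*Hy + 2*(s-1)*hed
    linarith [nonneg_of_mul_nonneg_left this hxy]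
  have s2 : s*(1-s) ≤ 0 := by
    have : 0 ≤ (-(s*(1-s)))*(d0^2+d1^2) := by linear_combination hz + hx - 2 * s * hed
    linarith [nonneg_of_mul_nonneg_left this hxy]
  have s3 : s*(1-s) = 0 := le_antisymm s2 (mul_nonneg s0 (by linarith))
  rcases mul_eq_zero.1 s3 with h | h
  · left; subst h; constructor <;> ring
  · right
    have : s = 1 := by linarith
    subst this; constructor <;> ring

lemma rd_pair_scalar (r ε c0 c1 L t0 t1 : ℝ) (hr : 0 < r) (hε : ε^2 = 1)
    (X Y V W A B : ℝ → ℝ)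
    (hX : ∀ t, HasDerivAt X (V t) t) (hY : ∀ t, HasDerivAt Y (W t) t)
    (hV : ∀ t, HasDerivAt V (A t) t) (hW : ∀ t, HasDerivAt W (B t) t)
    (hu : ∀ t, (V t)^2 + (W t)^2 = 1) (hc : ∀ t, (A t)^2 + (B t)^2 ≤ (1/r)^2)
    (pX : Function.Periodic X L) (pY : Function.Periodic Y L)
    (pV : Function.Periodic V L) (pW : Function.Periodic W L)
    (S : ∀ s t, 0 ≤ ε*(-(W t)*(X s - X t) + V t*(Y s - Y t)))
    (hout : ∀ t, r^2 ≤ (c0 - X t)^2 + (c1 - Y t)^2)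
    (h01 : t0 < t1) (h1L : t1 < t0 + L)
    (qa0 : X t0 - r*ε*W t0 = c0) (qa1 : Y t0 + r*ε*V t0 = c1)
    (qb0 : X t1 - r*ε*W t1 = c0) (qb1 : Y t1 + r*ε*V t1 = c1)
    (hne : 0 < (X t1 - X t0)^2 + (Y t1 - Y t0)^2)
    (he : 0 < (c0-(X t0+X t1)/2)^2+(c1-(Y t0+Y t1)/2)^2)
    (hinj : ∀ t ∈ Set.Ioo t0 (t0+L), t ≠ t1 → ¬ (X t = X t0 ∧ Y t = Y t0) ∧
      ¬ (X t = X t1 ∧ Y t = Y t1)) :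
    (∀ t ∈ Set.Icc t0 t1, X t - r*ε*W t = c0 ∧ Y t + r*ε*V t = c1) ∨
    (∀ t ∈ Set.Icc t1 (t0+L), X t - r*ε*W t = c0 ∧ Y t + r*ε*V t = c1) := by
  set h : ℝ → ℝ := fun t => (c0-(X t0+X t1)/2)*(X t - X t0) + (c1-(Y t0+Y t1)/2)*(Y t - Y t0)
    with hh
  have on0 : (c0 - X t0)^2 + (c1 - Y t0)^2 = r^2 := by
    rw [← qa0, ← qa1]; linear_combination r^2*ε^2*hu t0 + r^2 * hε
  have on1 : (c0 - X t1)^2 + (c1 - Y t1)^2 = r^2 := by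
    rw [← qb0, ← qb1]; linear_combination r^2*ε^2*hu t1 + r^2 * hε
  have T0 : ∀ t, 0 ≤ (c0 - X t0)*(X t - X t0) + (c1 - Y t0)*(Y t - Y t0) := by
    intro t
    have := mul_nonneg hr.le (S t t0)
    rw [← qa0, ← qa1]; linarith
  have T1 : ∀ t, 0 ≤ (c0 - X t1)*(X t - X t1) + (c1 - Y t1)*(Y t - Y t1) := by
    intro t
    have := mul_nonneg hr.le (S t t1)
    rw [← qb0, ← qb1]; linarith
  have hnz : ∀ t ∈ Set.Ioo t0 (t0+L), t ≠ t1 → h t ≠ 0 := by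
    intro t ht ht1 h0
    have := rd_line r c0 c1 _ _ _ _ _ _ on0 on1 (hout t) hne he (T0 t) (T1 t) h0
    have h2 := hinj t ht ht1
    tauto
  have dh : ∀ t, HasDerivAt h ((c0-(X t0+X t1)/2)*V t + (c1-(Y t0+Y t1)/2)*W t) t := by
    intro t
    exact (((hX t).sub_const _).const_mul _).fun_add (((hY t).sub_const _).const_mul _)
  have hcont : Continuous h := continuous_iff_continuousAt.2 fun t => (dh t).continuousAt
  have ht0 : h t0 = 0 := by simp [hh]
  have ht1 : h t1 = 0 := by
    simp only [hh]; linear_combination on0/2 - on1/2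
  have ph : Function.Periodic h L := by
    intro t; simp only [hh, pX t, pY t]
  obtain ⟨s, hs, hsneg⟩ : ∃ s ∈ Set.Ico t0 (t0+L), h s < 0 := by
    by_contra hcon
    push Not at hcon
    have hnn : ∀ t, 0 ≤ h t := by
      intro t
      obtain ⟨y, hy, hty⟩ := ph.exists_mem_Ico (by linarith) t t0
      rw [hty]; exact hcon y hy
    have hmin : IsLocalMin h t0 := Filter.Eventually.of_forall fun t => by rw [ht0]; exact hnn t
    have hd := hmin.hasDerivAt_eq_zero (dh t0)
    -- tangent at `t0` cannot be parallel to the chord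
    have k1 : (c0 - X t0)*V t0 + (c1 - Y t0)*W t0 = 0 := by
      rw [← qa0, ← qa1]; ring
    have k2 : (X t1 - X t0)*V t0 + (Y t1 - Y t0)*W t0 = 0 := by
      linear_combination 2*k1 - 2*hd
    have k3 : (c0 - X t0)*(X t1 - X t0) + (c1 - Y t0)*(Y t1 - Y t0) =
        ((X t1 - X t0)^2 + (Y t1 - Y t0)^2)/2 := by
      linear_combination on0/2 - on1/2
    have k4 : ((c0 - X t0)*(X t1 - X t0) + (c1 - Y t0)*(Y t1 - Y t0))^2 =
        r^2 * ((X t1 - X t0)^2 + (Y t1 - Y t0)^2) := by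
      have e1 : (c0 - X t0)*(Y t1 - Y t0) - (c1 - Y t0)*(X t1 - X t0) = 0 := by
        have e2 : ((c0 - X t0)*(Y t1 - Y t0) - (c1 - Y t0)*(X t1 - X t0)) * V t0 = 0 := by
          linear_combination (Y t1 - Y t0)*k1 - (c1 - Y t0)*k2
        have e3 : ((c0 - X t0)*(Y t1 - Y t0) - (c1 - Y t0)*(X t1 - X t0)) * W t0 = 0 := by
          linear_combination (c0 - X t0)*k2 - (X t1 - X t0)*k1
        linear_combination (-((c0 - X t0)*(Y t1 - Y t0) - (c1 - Y t0)*(X t1 - X t0)))*hu t0 +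
          V t0 * e2 + W t0 * e3
      linear_combination ((X t1 - X t0)^2 + (Y t1 - Y t0)^2)*on0 -
        ((c0 - X t0)*(Y t1 - Y t0) - (c1 - Y t0)*(X t1 - X t0))*e1
    -- then the chord has length `2r`, so the chord is a diameter
    rw [k3] at k4
    have k5 : ((X t1 - X t0)^2 + (Y t1 - Y t0)^2) = 4*r^2 := by
      have : ((X t1 - X t0)^2 + (Y t1 - Y t0)^2) *
        (((X t1 - X t0)^2 + (Y t1 - Y t0)^2) - 4*r^2) = 0 := by linear_combination 4*k4
      linarith [(mul_eq_zero.1 this).resolve_left hne.ne']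
    have k6 : (c0-(X t0+X t1)/2)^2+(c1-(Y t0+Y t1)/2)^2 = 0 := by
      linear_combination on0/2 + on1/2 - k5/4
    linarith
  have hsame : ∀ a b, Set.Ioo a b ⊆ Set.Ioo t0 (t0+L) → t1 ∉ Set.Ioo a b → s ∈ Set.Ioo a b →
      ∀ t ∈ Set.Ioo a b, h t < 0 := by
    intro a b hsub hnot hsab t ht
    by_contra hcon
    push Not at hcon
    have := (isPreconnected_Ioo (a := a) (b := b)).intermediate_value hsab ht hcont.continuousOn
    obtain ⟨u, hu1, hu2⟩ := this ⟨hsneg.le, hcon⟩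
    exact hnz u (hsub hu1) (fun h => hnot (h ▸ hu1)) hu2
  have hposn : ∀ t, h t < 0 →
      0 < ε * (-(W t) * (c0-(X t0+X t1)/2) + V t * (c1-(Y t0+Y t1)/2)) := by
    intro t ht
    have := rd_alg (c0-(X t0+X t1)/2) (c1-(Y t0+Y t1)/2) ((X t1 - X t0)/2) ((Y t1 - Y t0)/2)
      (X t - (X t0+X t1)/2) (Y t - (Y t0+Y t1)/2) (ε*(-W t)) (ε*V t)
      (by linear_combination on0/4 - on1/4)
      (by linear_combination ε^2*hu t + hε)
      (by linarith)
      (by linarith [T0 t])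
      (by linarith [T1 t])
      (by linarith [S t0 t])
      (by linarith [S t1 t])
      (by
        simp only [hh] at ht
        have : (c0-(X t0+X t1)/2)*((X t1 - X t0)/2) + (c1-(Y t0+Y t1)/2)*((Y t1 - Y t0)/2) = 0 := by
          linear_combination on0/4 - on1/4
        linarith)
    linarith
  have hs0 : s ≠ t0 := by rintro rfl; linarith
  have hs1 : s ≠ t1 := by rintro rfl; linarith
  rcases lt_or_gt_of_ne hs1 with hlt | hgt
  · left
    refine rd_core r ε c0 c1 (c0-(X t0+X t1)/2) (c1-(Y t0+Y t1)/2) t0 t1 hr hε X Y V W A B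
      hX hY hV hW hu hc ?_ qa0 qa1 qb0 qb1
    intro t ht
    refine hposn t (hsame t0 t1 ?_ ?_ ?_ t ht)
    · exact Set.Ioo_subset_Ioo_right h1L.le
    · simp
    · exact ⟨lt_of_le_of_ne hs.1 hs0.symm, hlt⟩
  · right
    refine rd_core r ε c0 c1 (c0-(X t0+X t1)/2) (c1-(Y t0+Y t1)/2) t1 (t0+L) hr hε X Y V W A B
      hX hY hV hW hu hc ?_ qb0 qb1 (by rw [pX, pW]; exact qa0) (by rw [pY, pV]; exact qa1)
    intro t ht
    refine hposn t (hsame t1 (t0+L) ?_ ?_ ?_ t ht)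
    · exact Set.Ioo_subset_Ioo_left h01.le
    · simp
    · exact ⟨hgt, hs.2⟩

lemma rd_coord (σ : ℝ → EuclideanSpace ℝ (Fin 2)) (v : EuclideanSpace ℝ (Fin 2)) (t : ℝ)
    (h : HasDerivAt σ v t) (i : Fin 2) : HasDerivAt (fun s => σ s i) (v i) t :=
  ((EuclideanSpace.proj i : EuclideanSpace ℝ (Fin 2) →L[ℝ] ℝ).hasFDerivAt).comp_hasDerivAt t h

lemma rd_norm_sq (x : EuclideanSpace ℝ (Fin 2)) : ‖x‖^2 = (x 0)^2 + (x 1)^2 := by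
  rw [EuclideanSpace.norm_sq_eq]; simp [Fin.sum_univ_two]

lemma rd_dist_sq (x y : EuclideanSpace ℝ (Fin 2)) :
    dist x y^2 = (x 0 - y 0)^2 + (x 1 - y 1)^2 := by
  rw [dist_eq_norm, rd_norm_sq]; simp

lemma rd_support (K : Set (EuclideanSpace ℝ (Fin 2))) (hconv : Convex ℝ K)
    (hint : (interior K).Nonempty) (σ : ℝ → EuclideanSpace ℝ (Fin 2))
    (v : EuclideanSpace ℝ (Fin 2)) (t : ℝ) (h : HasDerivAt σ v t) (hu : (v 0)^2 + (v 1)^2 = 1)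
    (hin : ∀ s, σ s ∈ K) (hnot : σ t ∉ interior K) :
    ∃ ε : ℝ, (ε = 1 ∨ ε = -1) ∧
      ∀ z ∈ K, 0 ≤ ε*(-(v 1)*(z 0 - σ t 0) + v 0 *(z 1 - σ t 1)) := by
  obtain ⟨f, hf⟩ := geometric_hahn_banach_open_point hconv.interior isOpen_interior hnot
  have hfK : ∀ z ∈ K, f z ≤ f (σ t) := by
    have h1 : closure (interior K) ⊆ {z | f z ≤ f (σ t)} :=
      closure_minimal (fun z hz => (hf z hz).le) (isClosed_le f.continuous continuous_const)
    rw [hconv.closure_interior_eq_closure_of_nonempty_interior hint] at h1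
    exact fun z hz => h1 (subset_closure hz)
  obtain ⟨α, hα⟩ : ∃ α, α = f (EuclideanSpace.single 0 1) := ⟨_, rfl⟩
  obtain ⟨β, hβ⟩ : ∃ β, β = f (EuclideanSpace.single 1 1) := ⟨_, rfl⟩
  have hfe : ∀ z, f z = α * z 0 + β * z 1 := by
    intro z
    have : z = z 0 • EuclideanSpace.single 0 (1:ℝ) + z 1 • EuclideanSpace.single 1 (1:ℝ) := by
      ext i; fin_cases i <;> simp
    conv_lhs => rw [this]
    rw [map_add, map_smul, map_smul, ← hα, ← hβ]
    simp only [smul_eq_mul]; ring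
  have hfv : f v = 0 := by
    have hmax : IsLocalMax (fun s => f (σ s)) t :=
      Filter.Eventually.of_forall fun s => hfK _ (hin s)
    exact hmax.hasDerivAt_eq_zero (f.hasFDerivAt.comp_hasDerivAt t h)
  rw [hfe] at hfv
  obtain ⟨μ, hμ⟩ : ∃ μ, μ = -α * v 1 + β * v 0 := ⟨_, rfl⟩
  have ha : α = μ * (-(v 1)) := by
    rw [hμ]; linear_combination (-α) * hu + v 0 * hfv
  have hb : β = μ * v 0 := by
    rw [hμ]; linear_combination (-β) * hu + v 1 * hfv
  have hK' : ∀ z ∈ K, μ * (-(v 1)*(z 0 - σ t 0) + v 0 *(z 1 - σ t 1)) ≤ 0 := by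
    intro z hz
    have := hfK z hz
    rw [hfe, hfe, ha, hb] at this
    linarith
  have hμ0 : μ ≠ 0 := by
    intro h0
    obtain ⟨z, hz⟩ := hint
    have := hf z hz
    rw [hfe, hfe, ha, hb, h0] at this
    simp at this
  rcases lt_or_gt_of_ne hμ0 with hl | hg
  · refine ⟨1, Or.inl rfl, fun z hz => ?_⟩
    have := hK' z hz
    by_contra hc
    push Not at hc
    rw [one_mul] at hc
    have := mul_pos_of_neg_of_neg hl hc
    linarith
  · refine ⟨-1, Or.inr rfl, fun z hz => ?_⟩
    have := hK' z hz
    by_contra hc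
    push Not at hc
    have := mul_pos hg (show 0 < (-(v 1)*(z 0 - σ t 0) + v 0 *(z 1 - σ t 1)) by linarith)
    linarith

lemma rd_support_ball (K : Set (EuclideanSpace ℝ (Fin 2))) (r : ℝ) (hr : 0 < r)
    (c p v : EuclideanSpace ℝ (Fin 2)) (hD : Metric.closedBall c r ⊆ K)
    (hu : (v 0)^2 + (v 1)^2 = 1) (ε : ℝ) (hε : ε^2 = 1)
    (h : ∀ z ∈ K, 0 ≤ ε*(-(v 1)*(z 0 - p 0) + v 0 *(z 1 - p 1))) :
    r ≤ ε*(-(v 1)*(c 0 - p 0) + v 0 *(c 1 - p 1)) := by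
  have hz : (!₂[c 0 + r*ε*v 1, c 1 - r*ε*v 0] : EuclideanSpace ℝ (Fin 2)) ∈ K := by
    apply hD
    rw [Metric.mem_closedBall]
    refine (sq_le_sq₀ dist_nonneg hr.le).1 ?_
    rw [rd_dist_sq]
    simp
    apply le_of_eq
    linear_combination r^2*ε^2*hu + r^2 * hε
  have := h _ hz
  simp at this
  have h2 : ε*(-(v 1)*(c 0 - p 0) + v 0 *(c 1 - p 1)) =
     ε * (-(v 1 * (c 0 + r * ε * v 1 - p 0)) + v 0 * (c 1 - r * ε * v 0 - p 1)) + r := by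
    linear_combination r*ε^2*hu + r * hε
  linarith

set_option maxHeartbeats 2000000 in
/-- For a radius-`r` rolling disk `D = closedBall c r ⊆ K` internally tangent at `p` to a
compact convex set `K` with `C²` boundary of curvature `|κ| ≤ 1/r`, the intersection
`∂D ∩ ∂K` is a single point, a pair of antipodal points of `∂D` (at distance `2r`), or a
connected arc of `∂D`; in particular `∂K` cannot cross `∂D` transversally. -/
theorem rolling_disk_contact_set (r L : ℝ) (hr : 0 < r) (hL : 0 < L)
    (K : Set (EuclideanSpace ℝ (Fin 2)))
    (hK : IsCompact K) (hconv : Convex ℝ K) (hint : (interior K).Nonempty)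
    (σ v a : ℝ → EuclideanSpace ℝ (Fin 2))
    (hper : Function.Periodic σ L) (hvper : Function.Periodic v L)
    (haper : Function.Periodic a L)
    (hderiv : ∀ t, HasDerivAt σ (v t) t)
    (hderiv2 : ∀ t, HasDerivAt v (a t) t)
    (hacont : Continuous a)
    (hunit : ∀ t, ‖v t‖ = 1)
    (hcurv : ∀ t, ‖a t‖ ≤ 1 / r)
    (hinj : Set.InjOn σ (Set.Ico 0 L))
    (hbdry : σ '' Set.Ico 0 L = frontier K)
    (c p : EuclideanSpace ℝ (Fin 2))
    (hD : Metric.closedBall c r ⊆ K)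
    (hp : p ∈ Metric.sphere c r ∩ frontier K) :
    (∃ x, Metric.sphere c r ∩ frontier K = {x}) ∨
    (∃ x y, x ≠ y ∧ dist x y = 2 * r ∧ Metric.sphere c r ∩ frontier K = {x, y}) ∨
    IsConnected (Metric.sphere c r ∩ frontier K) := by
  have hfr : ∀ t, σ t ∈ frontier K := by
    intro t
    obtain ⟨y, hy, hty⟩ := hper.exists_mem_Ico₀ hL t
    rw [hty, ← hbdry]; exact ⟨y, hy, rfl⟩
  have hin : ∀ t, σ t ∈ K := fun t => hK.isClosed.frontier_subset (hfr t)
  have hnot : ∀ t, σ t ∉ interior K := fun t => (hfr t).2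
  have hu : ∀ t, (v t 0)^2 + (v t 1)^2 = 1 := by
    intro t; rw [← rd_norm_sq, hunit]; norm_num
  have hc : ∀ t, (a t 0)^2 + (a t 1)^2 ≤ (1/r)^2 := by
    intro t; rw [← rd_norm_sq]
    exact pow_le_pow_left₀ (norm_nonneg _) (hcurv t) 2
  have hX := fun t => rd_coord σ _ t (hderiv t) 0
  have hY := fun t => rd_coord σ _ t (hderiv t) 1
  have hV := fun t => rd_coord v _ t (hderiv2 t) 0
  have hW := fun t => rd_coord v _ t (hderiv2 t) 1
  have hsup : ∀ t, ∃ ε : ℝ, (ε = 1 ∨ ε = -1) ∧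
      (∀ z ∈ K, 0 ≤ ε*(-(v t 1)*(z 0 - σ t 0) + v t 0 *(z 1 - σ t 1))) ∧
      r ≤ ε*(-(v t 1)*(c 0 - σ t 0) + v t 0 *(c 1 - σ t 1)) := by
    intro t
    obtain ⟨ε, h1, h2⟩ := rd_support K hconv hint σ (v t) t (hderiv t) (hu t) hin (hnot t)
    refine ⟨ε, h1, h2, rd_support_ball K r hr c (σ t) (v t) hD (hu t) ε ?_ h2⟩
    rcases h1 with rfl | rfl <;> norm_num
  -- the orientation is constant
  obtain ⟨ε, hε, hS, hSr⟩ : ∃ ε : ℝ, ε^2 = 1 ∧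
      (∀ t, ∀ z ∈ K, 0 ≤ ε*(-(v t 1)*(z 0 - σ t 0) + v t 0 *(z 1 - σ t 1))) ∧
      ∀ t, r ≤ ε*(-(v t 1)*(c 0 - σ t 0) + v t 0 *(c 1 - σ t 1)) := by
    set P : ℝ → ℝ := fun t => -(v t 1)*(c 0 - σ t 0) + v t 0 *(c 1 - σ t 1) with hP
    have hPc : Continuous P := by
      have cX : Continuous (fun t => σ t 0) := continuous_iff_continuousAt.2 fun t => (hX t).continuousAt
      have cY : Continuous (fun t => σ t 1) := continuous_iff_continuousAt.2 fun t => (hY t).continuousAt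
      have cV : Continuous (fun t => v t 0) := continuous_iff_continuousAt.2 fun t => (hV t).continuousAt
      have cW : Continuous (fun t => v t 1) := continuous_iff_continuousAt.2 fun t => (hW t).continuousAt
      exact (cW.neg.mul (continuous_const.sub cX)).add (cV.mul (continuous_const.sub cY))
    have hP0 : ∀ t, P t ≠ 0 := by
      intro t h0
      obtain ⟨ε, -, -, h3⟩ := hsup t
      have : ε * P t = 0 := by rw [h0, mul_zero]
      simp only [hP] at this
      linarith
    have hsel : ∀ t, (0 < P t → (∀ z ∈ K, 0 ≤ 1*(-(v t 1)*(z 0 - σ t 0) + v t 0 *(z 1 - σ t 1))) ∧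
        r ≤ 1*P t) ∧
        (P t < 0 → (∀ z ∈ K, 0 ≤ (-1)*(-(v t 1)*(z 0 - σ t 0) + v t 0 *(z 1 - σ t 1))) ∧
        r ≤ (-1)*P t) := by
      intro t
      obtain ⟨ε, h1, h2, h3⟩ := hsup t
      change r ≤ ε * P t at h3
      rcases h1 with rfl | rfl
      · refine ⟨fun _ => ⟨h2, h3⟩, fun h => ?_⟩
        exfalso; linarith
      · refine ⟨fun h => ?_, fun _ => ⟨h2, h3⟩⟩
        exfalso; linarith
    by_cases hall : ∀ t, 0 < P t
    · exact ⟨1, by norm_num, fun t => ((hsel t).1 (hall t)).1, fun t => ((hsel t).1 (hall t)).2⟩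
    · push Not at hall
      obtain ⟨t₀, ht₀⟩ := hall
      have hneg : ∀ t, P t < 0 := by
        intro t
        by_contra hcon
        push Not at hcon
        obtain ⟨u, hu0⟩ := mem_range_of_exists_le_of_exists_ge hPc ⟨t₀, ht₀⟩ ⟨t, hcon⟩
        exact hP0 u hu0
      exact ⟨-1, by norm_num, fun t => ((hsel t).2 (hneg t)).1, fun t => ((hsel t).2 (hneg t)).2⟩
  have hout : ∀ t, r^2 ≤ (c 0 - σ t 0)^2 + (c 1 - σ t 1)^2 := by
    intro t
    have h1 : σ t ∉ Metric.ball c r := fun hb =>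
      hnot t (interior_maximal (Metric.ball_subset_closedBall.trans hD) Metric.isOpen_ball hb)
    rw [Metric.mem_ball, not_lt, dist_comm] at h1
    rw [← rd_dist_sq]
    exact pow_le_pow_left₀ hr.le h1 2
  have hq : ∀ t, σ t ∈ Metric.sphere c r → σ t 0 - r*ε*v t 1 = c 0 ∧ σ t 1 + r*ε*v t 0 = c 1 := by
    intro t ht
    rw [Metric.mem_sphere] at ht
    have h1 : (σ t 0 - c 0)^2 + (σ t 1 - c 1)^2 = r^2 := by rw [← rd_dist_sq, ht]
    have h2 := mul_le_mul_of_nonneg_left (hSr t) hr.le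
    have h3 : (σ t 0 - r*ε*v t 1 - c 0)^2 + (σ t 1 + r*ε*v t 0 - c 1)^2 ≤ 0 := by
      have : (σ t 0 - r*ε*v t 1 - c 0)^2 + (σ t 1 + r*ε*v t 0 - c 1)^2 =
        2*r^2 - 2*(r*(ε*(-(v t 1)*(c 0 - σ t 0) + v t 0 *(c 1 - σ t 1)))) := by
        linear_combination h1 + r^2*ε^2*hu t + r^2*hε
      nlinarith
    constructor <;> nlinarith [sq_nonneg (σ t 0 - r*ε*v t 1 - c 0), sq_nonneg (σ t 1 + r*ε*v t 0 - c 1)]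
  have hq' : ∀ t, σ t 0 - r*ε*v t 1 = c 0 ∧ σ t 1 + r*ε*v t 0 = c 1 → σ t ∈ Metric.sphere c r := by
    rintro t ⟨h0, h1⟩
    rw [Metric.mem_sphere]
    have : dist (σ t) c ^ 2 = r^2 := by
      rw [rd_dist_sq, ← h0, ← h1]
      linear_combination r^2*ε^2*hu t + r^2*hε
    exact (pow_left_inj₀ dist_nonneg hr.le two_ne_zero).1 this
  have σcont : Continuous σ := continuous_iff_continuousAt.2 fun t => (hderiv t).continuousAt
  have hord : ∀ t0 ∈ Set.Ico 0 L, ∀ t1 ∈ Set.Ico 0 L, t0 < t1 →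
      σ t0 ∈ Metric.sphere c r → σ t1 ∈ Metric.sphere c r → dist (σ t0) (σ t1) ≠ 2*r →
      ∃ T ⊆ Metric.sphere c r ∩ frontier K, σ t0 ∈ T ∧ σ t1 ∈ T ∧ IsPreconnected T := by
    intro t0 m0 t1 m1 h01 k0 k1 hd
    have hne : σ t1 ≠ σ t0 := fun h => h01.ne' (hinj m1 m0 h)
    have hT : ∀ a b, (∀ t ∈ Set.Icc a b, σ t 0 - r*ε*v t 1 = c 0 ∧ σ t 1 + r*ε*v t 0 = c 1) →
        σ '' Set.Icc a b ⊆ Metric.sphere c r ∩ frontier K ∧ IsPreconnected (σ '' Set.Icc a b) := by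
      intro a b h
      refine ⟨?_, isPreconnected_Icc.image σ σcont.continuousOn⟩
      rintro _ ⟨t, ht, rfl⟩
      exact ⟨hq' t (h t ht), hfr t⟩
    have hsq : 0 < (σ t1 0 - σ t0 0)^2 + (σ t1 1 - σ t0 1)^2 := by
      rw [← rd_dist_sq]
      have := dist_pos.2 hne
      positivity
    have d0 : dist (σ t0) c ^ 2 = r^2 := by rw [Metric.mem_sphere.1 k0]
    have d1 : dist (σ t1) c ^ 2 = r^2 := by rw [Metric.mem_sphere.1 k1]
    rw [rd_dist_sq] at d0 d1
    have he : 0 < (c 0-(σ t0 0+σ t1 0)/2)^2+(c 1-(σ t0 1+σ t1 1)/2)^2 := by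
      refine lt_of_le_of_ne (by positivity) fun h0 => hd ?_
      refine (pow_left_inj₀ dist_nonneg (by positivity) two_ne_zero).1 ?_
      rw [rd_dist_sq]
      linear_combination 2*d0 + 2*d1 + 4 * h0
    have hmain := rd_pair_scalar r ε (c 0) (c 1) L t0 t1 hr hε (fun t => σ t 0) (fun t => σ t 1)
      (fun t => v t 0) (fun t => v t 1) (fun t => a t 0) (fun t => a t 1) hX hY hV hW hu hc
      (fun t => by simp only [hper t]) (fun t => by simp only [hper t])
      (fun t => by simp only [hvper t]) (fun t => by simp only [hvper t])
      (fun s t => hS t _ (hin s)) hout h01 (by linarith [m1.2, m0.1])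
      (hq t0 k0).1 (hq t0 k0).2 (hq t1 k1).1 (hq t1 k1).2 hsq he
      (by
        intro t ht ht1
        have hi : ∀ u ∈ Set.Ico 0 L, u = t0 ∨ u = t1 →
            ¬ (σ t 0 = σ u 0 ∧ σ t 1 = σ u 1) := by
          rintro u hu1 hu2 ⟨e0, e1⟩
          have e : σ t = σ u := by
            ext i; fin_cases i
            · exact e0
            · exact e1
          rcases lt_or_ge t L with hlt | hge
          · have := hinj ⟨m0.1.trans ht.1.le, hlt⟩ hu1 e
            rcases hu2 with rfl | rfl
            · exact ht.1.ne' this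
            · exact ht1 this
          · have e2 : σ (t - L) = σ u := by rw [hper.sub_eq, e]
            have h3 := ht.2
            have := hinj ⟨by linarith, by linarith [m0.2]⟩ hu1 e2
            rcases hu2 with rfl | rfl <;> linarith
        exact ⟨hi t0 m0 (Or.inl rfl), hi t1 m1 (Or.inr rfl)⟩)
    rcases hmain with h | h
    · refine ⟨_, (hT _ _ h).1, ⟨t0, ⟨le_rfl, h01.le⟩, rfl⟩, ⟨t1, ⟨h01.le, le_rfl⟩, rfl⟩, (hT _ _ h).2⟩
    · have hle : t1 ≤ t0 + L := by linarith [m1.2, m0.1]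
      refine ⟨_, (hT _ _ h).1, ⟨t0 + L, ⟨hle, le_rfl⟩, hper t0⟩, ⟨t1, ⟨le_rfl, hle⟩, rfl⟩,
        (hT _ _ h).2⟩
  have hpair : ∀ x ∈ Metric.sphere c r ∩ frontier K, ∀ y ∈ Metric.sphere c r ∩ frontier K,
      dist x y ≠ 2*r →
      ∃ T ⊆ Metric.sphere c r ∩ frontier K, x ∈ T ∧ y ∈ T ∧ IsPreconnected T := by
    intro x hx y hy hd
    have hx2 := hx.2
    have hy2 := hy.2
    rw [← hbdry] at hx2 hy2
    obtain ⟨t0, m0, rfl⟩ := hx2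
    obtain ⟨t1, m1, rfl⟩ := hy2
    rcases lt_trichotomy t0 t1 with h | h | h
    · exact hord t0 m0 t1 m1 h hx.1 hy.1 hd
    · subst h
      exact ⟨{σ t0}, Set.singleton_subset_iff.2 hx, rfl, rfl, isPreconnected_singleton⟩
    · obtain ⟨T, h1, h2, h3, h4⟩ := hord t1 m1 t0 m0 h hy.1 hx.1 (by rwa [dist_comm])
      exact ⟨T, h1, h3, h2, h4⟩
  -- the antipode is unique
  have hanti : ∀ x ∈ Metric.sphere c r, ∀ y ∈ Metric.sphere c r, dist x y = 2*r →
      ∀ i, x i + y i = 2 * c i := by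
    intro x hx y hy hd
    have d0 : dist x c ^ 2 = r^2 := by rw [Metric.mem_sphere.1 hx]
    have d1 : dist y c ^ 2 = r^2 := by rw [Metric.mem_sphere.1 hy]
    have d2 : dist x y ^ 2 = (2*r)^2 := by rw [hd]
    rw [rd_dist_sq] at d0 d1 d2
    have h3 : (x 0 + y 0 - 2 * c 0)^2 + (x 1 + y 1 - 2 * c 1)^2 = 0 := by
      linear_combination 2*d0 + 2*d1 - d2
    intro i
    fin_cases i
    · simp only [Fin.zero_eta]
      nlinarith [sq_nonneg (x 0 + y 0 - 2 * c 0), sq_nonneg (x 1 + y 1 - 2 * c 1)]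
    · simp only [Fin.mk_one]
      nlinarith [sq_nonneg (x 0 + y 0 - 2 * c 0), sq_nonneg (x 1 + y 1 - 2 * c 1)]
  by_cases hcase : ∃ x y, x ≠ y ∧ dist x y = 2 * r ∧ Metric.sphere c r ∩ frontier K = {x, y}
  · exact Or.inr (Or.inl hcase)
  · right; right
    refine ⟨⟨p, hp⟩, isPreconnected_of_forall_pair ?_⟩
    intro x hx y hy
    by_cases hd : dist x y = 2*r
    · have hxy : x ≠ y := by
        rintro rfl
        rw [dist_self] at hd
        linarith
      obtain ⟨z, hz, hzx, hzy⟩ : ∃ z ∈ Metric.sphere c r ∩ frontier K, z ≠ x ∧ z ≠ y := by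
        by_contra hcon
        push Not at hcon
        refine hcase ⟨x, y, hxy, hd, Set.Subset.antisymm ?_ ?_⟩
        · intro z hz
          by_cases h : z = x
          · exact Or.inl h
          · exact Or.inr (hcon z hz h)
        · rintro z (rfl | rfl)
          · exact hx
          · exact hy
      have a1 := hanti x hx.1 y hy.1 hd
      obtain ⟨T1, s1, x1, z1, p1⟩ := hpair x hx z hz (by
        intro h
        have a2 := hanti x hx.1 z hz.1 h
        exact hzy (by ext i; linarith [a1 i, a2 i]))
      obtain ⟨T2, s2, z2, y2, p2⟩ := hpair z hz y hy (by
        intro h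
        have a2 := hanti z hz.1 y hy.1 h
        exact hzx (by ext i; linarith [a1 i, a2 i]))
      exact ⟨T1 ∪ T2, Set.union_subset s1 s2, Or.inl x1, Or.inr y2, p1.union z z1 z2 p2⟩
    · exact hpair x hx y hy hd
end

section
/- Let σ : S¹ → ℝ² be a simple closed C¹, arc-length parametrized, piecewise C² curve with ‖σ''‖ ≤ 1/r wherever defined (r > 0), bounding a convex set K. Then for every pair of parameters t1, t2 with 0 < ‖σ(t1) − σ(t2)‖ < 2r, at least one of the two complementary subarcs of σ determined by t1, t2 is contained in D1 ∩ D2, where D1, D2 are the two closed disks of radius r whose boundary circles pass through both σ(t1) and σ(t2). -/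
lemma cvx_supp (K : Set (EuclideanSpace ℝ (Fin 2))) (hconv : Convex ℝ K)
    (hint : (interior K).Nonempty) (b : EuclideanSpace ℝ (Fin 2)) (hb : b ∈ frontier K) :
    ∃ α β : ℝ, (∀ y ∈ interior K, 0 < α * (y 0 - b 0) + β * (y 1 - b 1)) ∧
      (∀ y ∈ K, 0 ≤ α * (y 0 - b 0) + β * (y 1 - b 1)) := by
  obtain ⟨f, hf⟩ := geometric_hahn_banach_open_point hconv.interior isOpen_interior hb.2
  have hrep : ∀ y : EuclideanSpace ℝ (Fin 2), f y = f (EuclideanSpace.single 0 1) * y 0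
      + f (EuclideanSpace.single 1 1) * y 1 := by
    intro y
    have : y = y 0 • EuclideanSpace.single 0 (1:ℝ) + y 1 • EuclideanSpace.single 1 (1:ℝ) := by
      ext i; fin_cases i <;> simp
    conv_lhs => rw [this]
    simp only [map_add, map_smul, smul_eq_mul]; ring
  have h1 : ∀ y ∈ K, f y ≤ f b := by
    intro y hy
    have h2 : y ∈ closure (interior K) := by
      rw [hconv.closure_interior_eq_closure_of_nonempty_interior hint]
      exact subset_closure hy
    have h3 : closure (interior K) ⊆ {y | f y ≤ f b} :=
      closure_minimal (fun a ha => (hf a ha).le) (isClosed_le f.continuous continuous_const)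
    exact h3 h2
  refine ⟨-f (EuclideanSpace.single 0 1), -f (EuclideanSpace.single 1 1), ?_, ?_⟩
  · intro y hy
    have := hf y hy
    rw [hrep y, hrep b] at this
    linarith
  · intro y hy
    have := h1 y hy
    rw [hrep y, hrep b] at this
    linarith

lemma cvx_mid (K : Set (EuclideanSpace ℝ (Fin 2))) (hconv : Convex ℝ K)
    (hint : (interior K).Nonempty) (a b d : EuclideanSpace ℝ (Fin 2)) (hb : b ∈ frontier K)
    (ha : a ∈ K) (hd : d ∈ K) (α β c : ℝ) 
    (ga : α * a 0 + β * a 1 = c) (gb : α * b 0 + β * b 1 = c) (gd : α * d 0 + β * d 1 = c)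
    (h1 : -β * a 0 + α * a 1 < -β * b 0 + α * b 1)
    (h2 : -β * b 0 + α * b 1 < -β * d 0 + α * d 1) :
    (∀ y ∈ K, c ≤ α * y 0 + β * y 1) ∨ (∀ y ∈ K, α * y 0 + β * y 1 ≤ c) := by
  obtain ⟨α', β', hi, hs⟩ := cvx_supp K hconv hint b hb
  have hn : 0 < α ^ 2 + β ^ 2 := by
    by_contra hcon
    have e1 : α = 0 := by nlinarith [sq_nonneg α, sq_nonneg β]
    have e2 : β = 0 := by nlinarith [sq_nonneg α, sq_nonneg β]
    subst e1 e2; simp at h1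
  have key : ∀ y : EuclideanSpace ℝ (Fin 2), (α ^ 2 + β ^ 2) * (α' * (y 0 - b 0) + β' * (y 1 - b 1))
      = (α' * α + β' * β) * (α * y 0 + β * y 1 - c) + (-α' * β + β' * α) *
        ((-β * y 0 + α * y 1) - (-β * b 0 + α * b 1)) := by
    intro y; rw [← gb]; ring
  have ka := key a
  have kd := key d
  have pa := mul_nonneg hn.le (hs a ha)
  have pd := mul_nonneg hn.le (hs d hd)
  rw [ka, ga] at pa
  rw [kd, gd] at pd
  have hmu : -α' * β + β' * α = 0 := by
    apply le_antisymm
    · by_contra hcon; push Not at hcon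
      nlinarith [mul_pos hcon (sub_pos.2 h1)]
    · by_contra hcon; push Not at hcon
      nlinarith [mul_pos (neg_pos.2 hcon) (sub_pos.2 h2)]
  rcases le_total 0 (α' * α + β' * β) with hl | hl
  · left
    intro y hy
    have hp := mul_nonneg hn.le (hs y hy)
    rw [key y, hmu] at hp
    obtain ⟨y0, hy0⟩ := hint
    have hp0 := mul_pos hn (hi y0 hy0)
    rw [key y0, hmu] at hp0
    have : 0 < α' * α + β' * β := lt_of_le_of_ne hl (by intro h; rw [← h] at hp0; simp at hp0)
    by_contra hcon; push Not at hcon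
    nlinarith [mul_pos this (sub_pos.2 hcon)]
  · right
    intro y hy
    have hp := mul_nonneg hn.le (hs y hy)
    rw [key y, hmu] at hp
    obtain ⟨y0, hy0⟩ := hint
    have hp0 := mul_pos hn (hi y0 hy0)
    rw [key y0, hmu] at hp0
    have : α' * α + β' * β < 0 := lt_of_le_of_ne hl (by intro h; rw [h] at hp0; simp at hp0)
    by_contra hcon; push Not at hcon
    nlinarith [mul_pos (neg_pos.2 this) (sub_pos.2 hcon)]

lemma cvx_three (K : Set (EuclideanSpace ℝ (Fin 2))) (hconv : Convex ℝ K) (hcl : IsClosed K)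
    (hint : (interior K).Nonempty) (a b d : EuclideanSpace ℝ (Fin 2))
    (ha : a ∈ frontier K) (hb : b ∈ frontier K) (hd : d ∈ frontier K)
    (hab : a ≠ b) (had : a ≠ d) (hbd : b ≠ d) (α β c : ℝ) (hn : 0 < α ^ 2 + β ^ 2)
    (ga : α * a 0 + β * a 1 = c) (gb : α * b 0 + β * b 1 = c) (gd : α * d 0 + β * d 1 = c) :
    (∀ y ∈ K, c ≤ α * y 0 + β * y 1) ∨ (∀ y ∈ K, α * y 0 + β * y 1 ≤ c) := by
  have hne : ∀ x y : EuclideanSpace ℝ (Fin 2), x ≠ y → α * x 0 + β * x 1 = c →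
      α * y 0 + β * y 1 = c → -β * x 0 + α * x 1 ≠ -β * y 0 + α * y 1 := by
    intro x y hxy gx gy hk
    apply hxy
    have e0 : (α ^ 2 + β ^ 2) * (x 0 - y 0) = 0 := by
      linear_combination α * gx - α * gy - β * hk
    have e1 : (α ^ 2 + β ^ 2) * (x 1 - y 1) = 0 := by
      linear_combination β * gx - β * gy + α * hk
    have e0' := (mul_eq_zero.1 e0).resolve_left hn.ne'
    have e1' := (mul_eq_zero.1 e1).resolve_left hn.ne'
    ext i; fin_cases i
    · simpa [sub_eq_zero] using e0'
    · simpa [sub_eq_zero] using e1'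
  have fK : frontier K ⊆ K := hcl.frontier_subset
  have m := cvx_mid K hconv hint
  rcases lt_or_gt_of_ne (hne a b hab ga gb) with h1 | h1 <;>
  rcases lt_or_gt_of_ne (hne a d had ga gd) with h2 | h2 <;>
  rcases lt_or_gt_of_ne (hne b d hbd gb gd) with h3 | h3
  · exact m a b d hb (fK ha) (fK hd) α β c ga gb gd h1 h3
  · exact m a d b hd (fK ha) (fK hb) α β c ga gd gb h2 h3
  · linarith
  · exact m d a b ha (fK hd) (fK hb) α β c gd ga gb h2 h1
  · exact m b a d ha (fK hb) (fK hd) α β c gb ga gd h1 h2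
  · linarith
  · exact m b d a hd (fK hb) (fK ha) α β c gb gd ga h3 h2
  · exact m d b a hb (fK hd) (fK ha) α β c gd gb ga h3 h1

lemma cvx_per_inj (L : ℝ) (hL : 0 < L) (σ : ℝ → EuclideanSpace ℝ (Fin 2))
    (hper : Function.Periodic σ L) (hinj : Set.InjOn σ (Set.Ico 0 L)) (u w : ℝ)
    (h : σ u = σ w) (h1 : u - w < L) (h2 : w - u < L) : u = w := by
  have key : ∀ x, σ (toIcoMod hL 0 x) = σ x := by
    intro x
    rw [toIcoMod]
    exact hper.sub_zsmul_eq _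
  have mem : ∀ x, toIcoMod hL 0 x ∈ Set.Ico 0 L := by
    intro x; simpa using toIcoMod_mem_Ico hL 0 x
  have he : toIcoMod hL 0 u = toIcoMod hL 0 w := by
    apply hinj (mem u) (mem w)
    rw [key, key, h]
  rw [toIcoMod, toIcoMod] at he
  have he2 : u - w = ((toIcoDiv hL 0 u - toIcoDiv hL 0 w : ℤ) : ℝ) * L := by
    simp only [zsmul_eq_mul] at he
    push_cast; linarith
  set n := toIcoDiv hL 0 u - toIcoDiv hL 0 w
  have a1 : (n : ℝ) < 1 := by
    by_contra hc; push Not at hc; nlinarith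
  have a2 : (-1 : ℝ) < n := by
    by_contra hc; push Not at hc; nlinarith
  have a1' : n < 1 := by exact_mod_cast a1
  have a2' : -1 < n := by exact_mod_cast a2
  have : n = 0 := by omega
  rw [this] at he2; simp at he2; linarith

open Set Filter Topology in
lemma cvx_analytic (r a b : ℝ) (hr : 0 < r) (hab : a ≤ b) (H C S : ℝ → ℝ)
    (hH : ∀ s, HasDerivAt H (S s) s) (hC : Continuous C) (hScont : Continuous S)
    (hCS : ∀ s, C s ^ 2 + S s ^ 2 = 1)
    (hlip : ∀ s t, r ^ 2 * ((C s - C t) ^ 2 + (S s - S t) ^ 2) ≤ (s - t) ^ 2)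
    (hS : ∀ s ∈ Icc a b, 0 ≤ S s) : r * (C a - C b) ≤ H b - H a := by
  have main : ∀ ⦃x⦄, x ∈ Icc a b → -r * C x ≤ H x - H a - r * C a := by
    refine image_le_of_liminf_slope_right_le_deriv_boundary (f := fun x => -r * C x)
      (B := fun x => H x - H a - r * C a) (B' := S) (by fun_prop) (by simp) ?_ ?_ ?_
    · exact ContinuousOn.sub (ContinuousOn.sub
        (fun x _ => (hH x).continuousAt.continuousWithinAt) continuousOn_const) continuousOn_const
    · intro x _
      exact (((hH x).sub_const _).sub_const _).hasDerivWithinAt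
    · intro x hx ρ hρ
      apply Eventually.frequently
      have hSx := hS x (Ico_subset_Icc_self hx)
      have t1 : Tendsto (fun z => ρ ^ 2 * (4 - (z - x) ^ 2 / r ^ 2) - (S x + S z) ^ 2) (𝓝[>] x)
          (𝓝 (ρ ^ 2 * (4 - (x - x) ^ 2 / r ^ 2) - (S x + S x) ^ 2)) := by
        apply Tendsto.mono_left _ nhdsWithin_le_nhds
        apply Continuous.tendsto (f := fun z => ρ ^ 2 * (4 - (z - x) ^ 2 / r ^ 2) - (S x + S z) ^ 2)
        fun_prop
      have hpos : 0 < ρ ^ 2 * (4 - (x - x) ^ 2 / r ^ 2) - (S x + S x) ^ 2 := by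
        simp; nlinarith
      have ev := t1.eventually (lt_mem_nhds hpos)
      filter_upwards [ev, self_mem_nhdsWithin] with z hz hzx
      have hzx' : 0 < z - x := sub_pos.2 hzx
      rw [slope_def_field, div_lt_iff₀ hzx']
      by_contra hcon
      push Not at hcon
      have hcon' : ρ * (z - x) ≤ r * (C x - C z) := by linarith
      have hρ0 : 0 < ρ := lt_of_le_of_lt hSx hρ
      have sq : (ρ * (z - x)) ^ 2 ≤ (r * (C x - C z)) ^ 2 :=
        pow_le_pow_left₀ (by positivity) hcon' 2
      have l := hlip x z
      have id1 : (C x - C z) ^ 2 * (4 - ((C x - C z) ^ 2 + (S x - S z) ^ 2)) =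
          (S x + S z) ^ 2 * ((C x - C z) ^ 2 + (S x - S z) ^ 2) := by
        have e : (C x - C z) * (C x + C z) = - ((S x - S z) * (S x + S z)) := by
          linear_combination hCS x - hCS z
        have e2 : 4 - ((C x - C z) ^ 2 + (S x - S z) ^ 2) = (S x + S z) ^ 2 + (C x + C z) ^ 2 := by
          linear_combination -2 * hCS x - 2 * hCS z
        rw [e2]
        linear_combination ((C x - C z) * (C x + C z) - ((S x - S z) * (S x + S z))) * e
      set Q := (C x - C z) ^ 2 + (S x - S z) ^ 2
      set δ := z - x
      have l' : r ^ 2 * Q ≤ δ ^ 2 := by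
        have : (x - z) ^ 2 = δ ^ 2 := by simp only [δ]; ring
        linarith
      have lQ : Q ≤ δ ^ 2 / r ^ 2 := by rw [le_div_iff₀ (by positivity)]; linarith
      have hp4 : ρ ^ 2 * (4 - δ ^ 2 / r ^ 2) ≤ ρ ^ 2 * (4 - Q) := by
        apply mul_le_mul_of_nonneg_left _ (by positivity); linarith
      have h4 : 0 < 4 - Q := by
        by_contra hc; push Not at hc
        nlinarith [sq_nonneg (S x + S z), mul_nonneg (sq_nonneg ρ) (neg_nonneg.2 hc)]
      have f1 : (ρ * δ) ^ 2 * (4 - Q) ≤ (r * (C x - C z)) ^ 2 * (4 - Q) :=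
        mul_le_mul_of_nonneg_right sq h4.le
      have f2 : (r * (C x - C z)) ^ 2 * (4 - Q) = (S x + S z) ^ 2 * (r ^ 2 * Q) := by
        linear_combination r ^ 2 * id1
      have f3 : (S x + S z) ^ 2 * (r ^ 2 * Q) ≤ (S x + S z) ^ 2 * δ ^ 2 :=
        mul_le_mul_of_nonneg_left l' (sq_nonneg _)
      have f4 : (S x + S z) ^ 2 * δ ^ 2 < ρ ^ 2 * (4 - Q) * δ ^ 2 := by
        apply mul_lt_mul_of_pos_right _ (by positivity); linarith
      nlinarith
  have := main (right_mem_Icc.2 hab)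
  linarith

lemma cvx_coord (σ v : ℝ → EuclideanSpace ℝ (Fin 2)) (hderiv : ∀ t, HasDerivAt σ (v t) t)
    (i : Fin 2) (t : ℝ) : HasDerivAt (fun s => σ s i) (v t i) t := by
  have := (EuclideanSpace.proj (𝕜 := ℝ) i : EuclideanSpace ℝ (Fin 2) →L[ℝ] ℝ).hasFDerivAt.comp_hasDerivAt
    t (hderiv t)
  exact this

lemma cvx_mem_frontier (L : ℝ) (hL : 0 < L) (σ : ℝ → EuclideanSpace ℝ (Fin 2))
    (hper : Function.Periodic σ L) (K : Set (EuclideanSpace ℝ (Fin 2)))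
    (hbdry : σ '' Set.Ico 0 L = frontier K) (t : ℝ) : σ t ∈ frontier K := by
  rw [← hbdry]
  refine ⟨toIcoMod hL 0 t, by simpa using toIcoMod_mem_Ico hL 0 t, ?_⟩
  rw [toIcoMod]
  exact hper.sub_zsmul_eq _

lemma cvx_unit (x : EuclideanSpace ℝ (Fin 2)) (h : ‖x‖ = 1) : x 0 ^ 2 + x 1 ^ 2 = 1 := by
  have := EuclideanSpace.real_norm_sq_eq x
  rw [h, Fin.sum_univ_two] at this
  linarith

lemma cvx_dist_sq (x y : EuclideanSpace ℝ (Fin 2)) :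
    dist x y ^ 2 = (x 0 - y 0) ^ 2 + (x 1 - y 1) ^ 2 := by
  rw [dist_eq_norm, EuclideanSpace.real_norm_sq_eq, Fin.sum_univ_two]; simp

lemma cvx_orient (L : ℝ) (hL : 0 < L) (σ v : ℝ → EuclideanSpace ℝ (Fin 2))
    (hper : Function.Periodic σ L) (hderiv : ∀ t, HasDerivAt σ (v t) t)
    (hunit : ∀ t, ‖v t‖ = 1) (hcont : Continuous v)
    (K : Set (EuclideanSpace ℝ (Fin 2))) (hcl : IsClosed K)
    (hconv : Convex ℝ K) (hint : (interior K).Nonempty)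
    (hbdry : σ '' Set.Ico 0 L = frontier K) :
    ∃ ε : ℝ, ε ^ 2 = 1 ∧
      (∀ t, ∀ y ∈ K, 0 ≤ ε * (-(v t 1) * (y 0 - σ t 0) + v t 0 * (y 1 - σ t 1))) ∧
      (∀ t, ∀ y ∈ interior K, 0 < ε * (-(v t 1) * (y 0 - σ t 0) + v t 0 * (y 1 - σ t 1))) := by
  have hf := cvx_mem_frontier L hL σ hper K hbdry
  have hσ : Continuous σ := continuous_iff_continuousAt.2 fun t => (hderiv t).continuousAt
  have hlam : ∀ t, ∃ l : ℝ,
      (∀ y ∈ K, 0 ≤ l * (-(v t 1) * (y 0 - σ t 0) + v t 0 * (y 1 - σ t 1))) ∧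
      (∀ y ∈ interior K, 0 < l * (-(v t 1) * (y 0 - σ t 0) + v t 0 * (y 1 - σ t 1))) := by
    intro t
    obtain ⟨α, β, hi, hs⟩ := cvx_supp K hconv hint (σ t) (hf t)
    have hd : HasDerivAt (fun s => α * (σ s 0 - σ t 0) + β * (σ s 1 - σ t 1))
        (α * v t 0 + β * v t 1) t :=
      (((cvx_coord σ v hderiv 0 t).sub_const _).const_mul α).add
        (((cvx_coord σ v hderiv 1 t).sub_const _).const_mul β)
    have hm : IsLocalMin (fun s => α * (σ s 0 - σ t 0) + β * (σ s 1 - σ t 1)) t := by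
      apply Filter.Eventually.of_forall
      intro s
      have := hs (σ s) (hcl.frontier_subset (hf s))
      simpa using this
    have h0 := hm.hasDerivAt_eq_zero hd
    have hu := cvx_unit _ (hunit t)
    have key : ∀ y : EuclideanSpace ℝ (Fin 2), (-α * v t 1 + β * v t 0) *
        (-(v t 1) * (y 0 - σ t 0) + v t 0 * (y 1 - σ t 1)) =
        α * (y 0 - σ t 0) + β * (y 1 - σ t 1) := by
      intro y
      linear_combination (α * (y 0 - σ t 0) + β * (y 1 - σ t 1)) * hu -
        (v t 0 * (y 0 - σ t 0) + v t 1 * (y 1 - σ t 1)) * h0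
    refine ⟨-α * v t 1 + β * v t 0, ?_, ?_⟩
    · intro y hy; rw [key]; exact hs y hy
    · intro y hy; rw [key]; exact hi y hy
  obtain ⟨y0, hy0⟩ := hint
  have hkc : Continuous fun t => -(v t 1) * (y0 0 - σ t 0) + v t 0 * (y0 1 - σ t 1) := by
    fun_prop
  have hk0 : ∀ t, -(v t 1) * (y0 0 - σ t 0) + v t 0 * (y0 1 - σ t 1) ≠ 0 := by
    intro t h
    obtain ⟨l, _, h2⟩ := hlam t
    have := h2 y0 hy0
    rw [h] at this; simp at this
  have hsign : (∀ t, 0 < -(v t 1) * (y0 0 - σ t 0) + v t 0 * (y0 1 - σ t 1)) ∨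
      (∀ t, -(v t 1) * (y0 0 - σ t 0) + v t 0 * (y0 1 - σ t 1) < 0) := by
    by_contra hcon
    push Not at hcon
    obtain ⟨⟨t, ht⟩, ⟨s, hs⟩⟩ := hcon
    obtain ⟨u, hu⟩ := mem_range_of_exists_le_of_exists_ge hkc ⟨t, ht⟩ ⟨s, hs⟩
    exact hk0 u hu
  rcases hsign with hsg | hsg
  · have hl : ∀ t l, (∀ y ∈ interior K, 0 < l * (-(v t 1) * (y 0 - σ t 0) + v t 0 * (y 1 - σ t 1)))
        → 0 < l := fun t l h => pos_of_mul_pos_left (h y0 hy0) (hsg t).le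
    refine ⟨1, by norm_num, ?_, ?_⟩
    · intro t y hy
      obtain ⟨l, h1, h2⟩ := hlam t
      rw [one_mul]
      exact nonneg_of_mul_nonneg_right (h1 y hy) (hl t l h2)
    · intro t y hy
      obtain ⟨l, h1, h2⟩ := hlam t
      rw [one_mul]
      exact pos_of_mul_pos_right (h2 y hy) (hl t l h2).le
  · have hl : ∀ t l, (∀ y ∈ interior K, 0 < l * (-(v t 1) * (y 0 - σ t 0) + v t 0 * (y 1 - σ t 1)))
        → l < 0 := by
      intro t l h
      by_contra hc; push Not at hc
      nlinarith [h y0 hy0, mul_nonneg hc (neg_pos.2 (hsg t)).le]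
    refine ⟨-1, by norm_num, ?_, ?_⟩
    · intro t y hy
      obtain ⟨l, h1, h2⟩ := hlam t
      have := h1 y hy
      have hl' := hl t l h2
      by_contra hc; push Not at hc
      nlinarith
    · intro t y hy
      obtain ⟨l, h1, h2⟩ := hlam t
      have := h2 y hy
      have hl' := hl t l h2
      by_contra hc; push Not at hc
      nlinarith

open Set in
lemma cvx_rolling_ineq (r L : ℝ) (hr : 0 < r) (hL : 0 < L) (σ v : ℝ → EuclideanSpace ℝ (Fin 2))
    (hper : Function.Periodic σ L) (hvper : Function.Periodic v L)
    (hderiv : ∀ t, HasDerivAt σ (v t) t)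
    (hunit : ∀ t, ‖v t‖ = 1) (hcont : Continuous v)
    (hlip : ∀ s t : ℝ, ‖v s - v t‖ ≤ (1 / r) * |s - t|)
    (hinj : Set.InjOn σ (Set.Ico 0 L))
    (K : Set (EuclideanSpace ℝ (Fin 2))) (hcl : IsClosed K)
    (hconv : Convex ℝ K) (hint : (interior K).Nonempty)
    (hbdry : σ '' Set.Ico 0 L = frontier K)
    (ε : ℝ) (hε : ε ^ 2 = 1)
    (hs : ∀ t, ∀ y ∈ K, 0 ≤ ε * (-(v t 1) * (y 0 - σ t 0) + v t 0 * (y 1 - σ t 1)))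
    (t s : ℝ) (hts : s ∈ Icc t (t + L)) :
    r * (1 - (v s 0 * v t 0 + v s 1 * v t 1)) ≤
      ε * (-(v t 1) * (σ s 0 - σ t 0) + v t 0 * (σ s 1 - σ t 1)) := by
  have hf := cvx_mem_frontier L hL σ hper K hbdry
  have hσ : Continuous σ := continuous_iff_continuousAt.2 fun t => (hderiv t).continuousAt
  have fK : frontier K ⊆ K := hcl.frontier_subset
  set H : ℝ → ℝ := fun s => ε * (-(v t 1) * (σ s 0 - σ t 0) + v t 0 * (σ s 1 - σ t 1)) with hH
  set S : ℝ → ℝ := fun s => ε * (-(v t 1) * v s 0 + v t 0 * v s 1) with hS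
  set C : ℝ → ℝ := fun s => v s 0 * v t 0 + v s 1 * v t 1 with hC
  have hHd : ∀ s, HasDerivAt H (S s) s := fun s =>
    ((((cvx_coord σ v hderiv 0 s).sub_const _).const_mul _).add
      (((cvx_coord σ v hderiv 1 s).sub_const _).const_mul _)).const_mul ε
  have hHc : Continuous H := by fun_prop
  have hSc : Continuous S := by fun_prop
  have hCc : Continuous C := by fun_prop
  have hut := cvx_unit _ (hunit t)
  have hCS : ∀ s, C s ^ 2 + S s ^ 2 = 1 := by
    intro s
    have hus := cvx_unit _ (hunit s)
    simp only [hC, hS]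
    linear_combination (-(v t 1) * v s 0 + v t 0 * v s 1) ^ 2 * hε + hut * (v s 0 ^ 2 + v s 1 ^ 2)
      + hus
  have hlip' : ∀ a b, r ^ 2 * ((C a - C b) ^ 2 + (S a - S b) ^ 2) ≤ (a - b) ^ 2 := by
    intro a b
    have e : (C a - C b) ^ 2 + (S a - S b) ^ 2 = ‖v a - v b‖ ^ 2 := by
      rw [EuclideanSpace.real_norm_sq_eq, Fin.sum_univ_two]
      simp only [hC, hS, PiLp.sub_apply]
      linear_combination (-(v t 1) * (v a 0 - v b 0) + v t 0 * (v a 1 - v b 1)) ^ 2 * hε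
        + hut * ((v a 0 - v b 0) ^ 2 + (v a 1 - v b 1) ^ 2)
    rw [e]
    have h1 : r * ‖v a - v b‖ ≤ |a - b| := by
      have := mul_le_mul_of_nonneg_left (hlip a b) hr.le
      rwa [← mul_assoc, mul_one_div_cancel hr.ne', one_mul] at this
    have h2 := pow_le_pow_left₀ (by positivity) h1 2
    rw [sq_abs] at h2
    linarith
  have hH0 : ∀ s, 0 ≤ H s := fun s => hs t (σ s) (fK (hf s))
  have hHt : H t = 0 := by simp [hH]
  have hHtL : H (t + L) = 0 := by simp [hH, hper t]
  -- three points on a level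
  have three : ∀ a b d c, t < a → a < b → b < d → d < t + L → H a = c → H b = c → H d = c →
      (∀ s, c ≤ H s) ∨ (∀ s, H s ≤ c) := by
    intro a b d c ha hab hbd hd ga gb gd
    have inj := cvx_per_inj L hL σ hper hinj
    have r0 : ∀ s, H s = (ε * -(v t 1)) * σ s 0 + (ε * v t 0) * σ s 1 -
        ((ε * -(v t 1)) * σ t 0 + (ε * v t 0) * σ t 1) := by
      intro s; simp only [hH]; ring
    have := cvx_three K hconv hcl hint (σ a) (σ b) (σ d) (hf a) (hf b) (hf d)
      (fun h => by have := inj a b h (by linarith) (by linarith); linarith)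
      (fun h => by have := inj a d h (by linarith) (by linarith); linarith)
      (fun h => by have := inj b d h (by linarith) (by linarith); linarith)
      (ε * -(v t 1)) (ε * v t 0) (c + ((ε * -(v t 1)) * σ t 0 + (ε * v t 0) * σ t 1))
      (by
        have : (ε * -(v t 1)) ^ 2 + (ε * v t 0) ^ 2 = 1 := by
          linear_combination (v t 0 ^ 2 + v t 1 ^ 2) * hε + hut
        rw [this]; norm_num)
      (by linarith [r0 a]) (by linarith [r0 b]) (by linarith [r0 d])
    rcases this with h | h
    · left; intro s; have := h _ (fK (hf s)); linarith [r0 s]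
    · right; intro s; have := h _ (fK (hf s)); linarith [r0 s]
  obtain ⟨m, hm, hmax⟩ := isCompact_Icc.exists_isMaxOn (nonempty_Icc.2 (by linarith : t ≤ t + L))
    hHc.continuousOn
  have hmax' : ∀ x ∈ Icc t (t + L), H x ≤ H m := fun x hx => hmax hx
  have mono : MonotoneOn H (Icc t m) := by
    intro s1 h1 s2 h2 h12
    by_contra hcon; push Not at hcon
    obtain ⟨c, hc1, hc2⟩ := exists_between hcon
    have g2 := hH0 s2
    have g1 := hmax' s1 ⟨h1.1, by linarith [h1.2, hm.2]⟩
    obtain ⟨a, ha, hac⟩ := intermediate_value_Ioo h1.1 hHc.continuousOn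
      (⟨by linarith, hc2⟩ : c ∈ Ioo (H t) (H s1))
    obtain ⟨b, hb, hbc⟩ := intermediate_value_Ioo' h12 hHc.continuousOn
      (⟨hc1, hc2⟩ : c ∈ Ioo (H s2) (H s1))
    obtain ⟨d, hd, hdc⟩ := intermediate_value_Ioo h2.2 hHc.continuousOn
      (⟨hc1, by linarith⟩ : c ∈ Ioo (H s2) (H m))
    rcases three a b d c ha.1 (by linarith [ha.2, hb.1]) (by linarith [hb.2, hd.1])
      (by linarith [hd.2, hm.2]) hac hbc hdc with h | h
    · linarith [h s2]
    · linarith [h s1]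
  have anti : AntitoneOn H (Icc m (t + L)) := by
    intro s1 h1 s2 h2 h12
    by_contra hcon; push Not at hcon
    obtain ⟨c, hc1, hc2⟩ := exists_between hcon
    have g1 := hH0 s1
    have g2 := hmax' s2 ⟨by linarith [h2.1, hm.1], h2.2⟩
    obtain ⟨a, ha, hac⟩ := intermediate_value_Ioo' h1.1 hHc.continuousOn
      (⟨hc1, by linarith⟩ : c ∈ Ioo (H s1) (H m))
    obtain ⟨b, hb, hbc⟩ := intermediate_value_Ioo h12 hHc.continuousOn
      (⟨hc1, hc2⟩ : c ∈ Ioo (H s1) (H s2))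
    obtain ⟨d, hd, hdc⟩ := intermediate_value_Ioo' h2.2 hHc.continuousOn
      (⟨by linarith, hc2⟩ : c ∈ Ioo (H (t + L)) (H s2))
    rcases three a b d c (by linarith [ha.1, hm.1]) (by linarith [ha.2, hb.1])
      (by linarith [hb.2, hd.1]) hd.2 hac hbc hdc with h | h
    · linarith [h s1]
    · linarith [h s2]
  have hCt : C t = 1 := by simp only [hC]; linarith
  have hCtL : C (t + L) = 1 := by simp only [hC, hvper t]; linarith
  -- derivative signs
  have Spos : ∀ a b, t ≤ a → b ≤ m → a < b → ∀ x ∈ Icc a b, 0 ≤ S x := by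
    intro a b ha hb hab x hx
    have : HasDerivWithinAt H (S x) (Icc a b) x := (hHd x).hasDerivWithinAt
    rw [← this.derivWithin (uniqueDiffOn_Icc hab x hx)]
    exact (mono.mono (Icc_subset_Icc ha hb)).derivWithin_nonneg
  have Sneg : ∀ a b, m ≤ a → b ≤ t + L → a < b → ∀ x ∈ Icc a b, S x ≤ 0 := by
    intro a b ha hb hab x hx
    have : HasDerivWithinAt H (S x) (Icc a b) x := (hHd x).hasDerivWithinAt
    rw [← this.derivWithin (uniqueDiffOn_Icc hab x hx)]
    exact (anti.mono (Icc_subset_Icc ha hb)).derivWithin_nonpos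
  change r * (1 - C s) ≤ H s
  rcases le_total s m with hsm | hsm
  · rcases eq_or_lt_of_le hts.1 with h | h
    · rw [← h, hCt, hHt]; simp
    · have := cvx_analytic r t s hr h.le H C S hHd hCc hSc hCS hlip' (Spos t s le_rfl hsm h)
      rw [hCt, hHt] at this; linarith
  · rcases eq_or_lt_of_le hts.2 with h | h
    · rw [h, hCtL, hHtL]; simp
    · have := cvx_analytic r s (t + L) hr h.le (fun x => -H x) (fun x => -C x) (fun x => -S x)
        (fun x => (hHd x).neg) hCc.neg hSc.neg (fun x => by rw [neg_sq, neg_sq]; exact hCS x)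
        (fun a b => by have := hlip' a b; nlinarith)
        (fun x hx => by have := Sneg s (t + L) hsm le_rfl h x hx; linarith)
      rw [hCtL, hHtL] at this; linarith

lemma cvx_halfplanes (L : ℝ) (σ v : ℝ → EuclideanSpace ℝ (Fin 2))
    (K : Set (EuclideanSpace ℝ (Fin 2))) (hcl : IsClosed K)
    (hint : (interior K).Nonempty)
    (hbdry : σ '' Set.Ico 0 L = frontier K) (ε : ℝ)
    (hi : ∀ t, ∀ y ∈ interior K, 0 < ε * (-(v t 1) * (y 0 - σ t 0) + v t 0 * (y 1 - σ t 1)))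
    (y : EuclideanSpace ℝ (Fin 2))
    (hy : ∀ t, 0 ≤ ε * (-(v t 1) * (y 0 - σ t 0) + v t 0 * (y 1 - σ t 1))) : y ∈ K := by
  by_contra hyK
  obtain ⟨y0, hy0⟩ := hint
  have hpc : IsPreconnected (segment ℝ y0 y) := (convex_segment y0 y).isPreconnected
  obtain ⟨b, hb1, hb2⟩ : ∃ b, b ∈ segment ℝ y0 y ∧ b ∈ frontier K := by
    by_contra hcon
    push Not at hcon
    obtain ⟨w, _, hw1, hw2⟩ := hpc (interior K) Kᶜ isOpen_interior hcl.isOpen_compl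
      (by
        intro w hw
        by_cases hwK : w ∈ K
        · left
          by_contra hwi
          exact hcon w hw ⟨subset_closure hwK, hwi⟩
        · exact Or.inr hwK)
      ⟨y0, left_mem_segment ℝ _ _, hy0⟩ ⟨y, right_mem_segment ℝ _ _, hyK⟩
    exact hw2 (interior_subset hw1)
  have hbK := hcl.frontier_subset hb2
  rw [← hbdry] at hb2
  obtain ⟨t, _, ht⟩ := hb2
  obtain ⟨p, q, hp, hq, hpq, rfl⟩ := hb1
  have h0 := hi t y0 hy0
  have h1 := hy t
  have hp0 : 0 < p := by
    rcases hp.eq_or_lt with h | h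
    · exfalso; apply hyK
      rw [← h] at hpq
      have : q = 1 := by linarith
      rw [← h, this] at hbK
      simpa using hbK
    · exact h
  have e0 : σ t 0 = p * y0 0 + q * y 0 := by rw [ht]; simp
  have e1 : σ t 1 = p * y0 1 + q * y 1 := by rw [ht]; simp
  have : p * (ε * (-(v t 1) * (y0 0 - σ t 0) + v t 0 * (y0 1 - σ t 1))) +
    q * (ε * (-(v t 1) * (y 0 - σ t 0) + v t 0 * (y 1 - σ t 1))) = 0 := by
    have : p = 1 - q := by linarith
    subst this
    rw [e0, e1]; ring
  nlinarith [mul_pos hp0 h0, mul_nonneg hq h1]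

/-- Blaschke rolling: every boundary point lies in a disk of radius `r` inside `K`. -/
lemma cvx_rolling (r L : ℝ) (hr : 0 < r) (hL : 0 < L) (σ v : ℝ → EuclideanSpace ℝ (Fin 2))
    (hper : Function.Periodic σ L) (hvper : Function.Periodic v L)
    (hderiv : ∀ t, HasDerivAt σ (v t) t)
    (hunit : ∀ t, ‖v t‖ = 1) (hcont : Continuous v)
    (hlip : ∀ s t : ℝ, ‖v s - v t‖ ≤ (1 / r) * |s - t|)
    (hinj : Set.InjOn σ (Set.Ico 0 L))
    (K : Set (EuclideanSpace ℝ (Fin 2))) (hcl : IsClosed K)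
    (hconv : Convex ℝ K) (hint : (interior K).Nonempty)
    (hbdry : σ '' Set.Ico 0 L = frontier K) (s : ℝ) :
    ∃ z : EuclideanSpace ℝ (Fin 2), Metric.closedBall z r ⊆ K ∧ dist (σ s) z ≤ r := by
  obtain ⟨ε, hε, hs, hi⟩ := cvx_orient L hL σ v hper hderiv hunit hcont K hcl hconv hint hbdry
  have hus := cvx_unit _ (hunit s)
  refine ⟨!₂[σ s 0 - r * ε * v s 1, σ s 1 + r * ε * v s 0], ?_, ?_⟩
  · intro y hy
    apply cvx_halfplanes L σ v K hcl hint hbdry ε hi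
    intro t
    -- shift `s`
    obtain ⟨s', hs', e1, e2⟩ : ∃ s' ∈ Set.Icc t (t + L), σ s' = σ s ∧ v s' = v s := by
      refine ⟨toIcoMod hL t s, Set.Ico_subset_Icc_self (toIcoMod_mem_Ico hL t s), ?_, ?_⟩
      · rw [toIcoMod]; exact hper.sub_zsmul_eq _
      · rw [toIcoMod]; exact hvper.sub_zsmul_eq _
    have main := cvx_rolling_ineq r L hr hL σ v hper hvper hderiv hunit hcont hlip hinj K hcl hconv
      hint hbdry ε hε hs t s' hs'
    rw [e1, e2] at main
    have hut := cvx_unit _ (hunit t)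
    rw [Metric.mem_closedBall] at hy
    have hy2 := pow_le_pow_left₀ dist_nonneg hy 2
    rw [cvx_dist_sq] at hy2
    simp only [Matrix.cons_val_zero, Matrix.cons_val_one] at hy2
    set a := y 0 - (σ s 0 - r * ε * v s 1)
    set b := y 1 - (σ s 1 + r * ε * v s 0)
    have e : ε * (-(v t 1) * (y 0 - σ t 0) + v t 0 * (y 1 - σ t 1)) =
      ε * (-(v t 1) * (σ s 0 - σ t 0) + v t 0 * (σ s 1 - σ t 1)) +
      r * (v s 0 * v t 0 + v s 1 * v t 1) + ε * (-(v t 1) * a + v t 0 * b) := by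
      simp only [a, b]
      linear_combination (r * (v s 0 * v t 0 + v s 1 * v t 1)) * hε
    have hsq : (ε * (-(v t 1) * a + v t 0 * b)) ^ 2 ≤ r ^ 2 := by
      have : (ε * (-(v t 1) * a + v t 0 * b)) ^ 2 = (a ^ 2 + b ^ 2) - (v t 0 * a + v t 1 * b) ^ 2 := by
        linear_combination (-(v t 1) * a + v t 0 * b) ^ 2 * hε + (a ^ 2 + b ^ 2) * hut
      nlinarith [sq_nonneg (v t 0 * a + v t 1 * b)]
    have := (abs_le_of_sq_le_sq' hsq hr.le).1
    linarith
  · apply abs_le_of_sq_le_sq' _ hr.le |>.2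
    rw [cvx_dist_sq]
    simp only [Matrix.cons_val_zero, Matrix.cons_val_one]
    have : (σ s 0 - (σ s 0 - r * ε * v s 1)) ^ 2 + (σ s 1 - (σ s 1 + r * ε * v s 0)) ^ 2 = r ^ 2 := by
      linear_combination r ^ 2 * (v s 0 ^ 2 + v s 1 ^ 2) * hε + r ^ 2 * hus
    exact this.le

lemma cvx_noint (K : Set (EuclideanSpace ℝ (Fin 2))) (α β : ℝ) (hn : 0 < α ^ 2 + β ^ 2)
    (y : EuclideanSpace ℝ (Fin 2)) (hy : y ∈ interior K) :
    ∃ w ∈ K, α * w 0 + β * w 1 < α * y 0 + β * y 1 := by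
  have hc : Continuous fun δ : ℝ => y - δ • (!₂[α, β] : EuclideanSpace ℝ (Fin 2)) := by fun_prop
  have h0 : Filter.Tendsto (fun δ : ℝ => y - δ • (!₂[α, β] : EuclideanSpace ℝ (Fin 2)))
      (nhdsWithin 0 (Set.Ioi 0)) (nhds y) := by
    have := (hc.tendsto 0).mono_left (nhdsWithin_le_nhds (s := Set.Ioi 0))
    simpa using this
  have ev := h0.eventually (isOpen_interior.mem_nhds hy)
  obtain ⟨δ, h1, h2⟩ := (ev.and self_mem_nhdsWithin).exists
  refine ⟨_, interior_subset h1, ?_⟩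
  have h2' : 0 < δ := h2
  simp
  nlinarith [mul_pos h2' hn]

lemma cvx_scalar (k ζ η ξ ω γ : ℝ)
    (hball : ∀ τ : ℝ, (τ - ζ) ^ 2 + η ^ 2 ≤ k → -(1 / 2) ≤ τ ∧ τ ≤ 1 / 2)
    (hx : (ξ - ζ) ^ 2 + (ω - η) ^ 2 ≤ k) (hγ : 1 / 4 + γ ^ 2 = k)
    (hout : k < ξ ^ 2 + (ω - γ) ^ 2) (hω : 0 < ω) : 0 < η := by
  by_contra hη
  push Not at hη
  have hk : η ^ 2 ≤ k := by nlinarith [sq_nonneg (ξ - ζ), mul_nonneg hω.le (neg_nonneg.2 hη)]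
  set s := Real.sqrt (k - η ^ 2) with hs
  have hs0 : 0 ≤ s := Real.sqrt_nonneg _
  have hs2 : s ^ 2 = k - η ^ 2 := Real.sq_sqrt (by linarith)
  have b1 := (hball (ζ + s) (by nlinarith)).2
  have b2 := (hball (ζ - s) (by nlinarith)).1
  have hs12 : s ≤ 1 / 2 := by linarith
  have hγη : |γ| ≤ |η| := by
    apply sq_le_sq.1
    nlinarith
  rw [abs_of_nonpos hη] at hγη
  have hγ1 := (abs_le.1 hγη).1
  have hxs : (ξ - ζ) ^ 2 ≤ s ^ 2 := by
    nlinarith [mul_nonneg hω.le (neg_nonneg.2 hη), sq_nonneg ω]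
  have hxs' := abs_le_of_sq_le_sq' hxs hs0
  have hA : (ξ - ζ) ^ 2 + ω ^ 2 - 2 * ω * η ≤ s ^ 2 := by nlinarith
  have hB : 1 / 4 < ξ ^ 2 + ω ^ 2 - 2 * ω * γ := by nlinarith
  have hC : ω * η ≤ ω * γ := mul_le_mul_of_nonneg_left (by linarith) hω.le
  have hD : 1 / 4 < s ^ 2 + 2 * ξ * ζ - ζ ^ 2 := by nlinarith
  rcases le_total 0 ζ with h | h
  · nlinarith [mul_nonneg h (sub_nonneg.2 (by linarith : ξ ≤ ζ + s))]
  · nlinarith [mul_nonneg (neg_nonneg.2 h) (sub_nonneg.2 (by linarith : ζ - s ≤ ξ))]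

lemma cvx_sign (f : ℝ → ℝ) (hf : Continuous f) (a b : ℝ) 
    (h : ∀ x ∈ Set.Ioo a b, f x ≠ 0) :
    (∀ x ∈ Set.Ioo a b, 0 < f x) ∨ (∀ x ∈ Set.Ioo a b, f x < 0) := by
  by_contra hcon
  push Not at hcon
  obtain ⟨⟨x, hx, hx0⟩, ⟨y, hy, hy0⟩⟩ := hcon
  have := isPreconnected_Ioo.intermediate_value hx hy hf.continuousOn
  obtain ⟨z, hz, hz0⟩ := this ⟨hx0, hy0⟩
  exact h z hz hz0

/-- A connected part of the boundary containing `σ t1`, `σ t2` contains a point of any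
separating pair. -/
lemma cvx_separate (L : ℝ) (hL : 0 < L) (σ : ℝ → EuclideanSpace ℝ (Fin 2))
    (hper : Function.Periodic σ L) (hσ : Continuous σ) (hinj : Set.InjOn σ (Set.Ico 0 L))
    (K : Set (EuclideanSpace ℝ (Fin 2))) (hbdry : σ '' Set.Ico 0 L = frontier K)
    (t1 t2 s s' : ℝ) (h1 : t1 < s) (h2 : s < t2) (h3 : t2 < s') (h4 : s' < t1 + L)
    (G : Set (EuclideanSpace ℝ (Fin 2))) (hG : IsPreconnected G) (hGf : G ⊆ frontier K)
    (hp : σ t1 ∈ G) (hq : σ t2 ∈ G) : σ s ∈ G ∨ σ s' ∈ G := by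
  obtain ⟨w, hwG, ⟨a, ha, haw⟩, ⟨b, hb, hbw⟩⟩ := isPreconnected_closed_iff.1 hG
    (σ '' Set.Icc s s') (σ '' Set.Icc s' (s + L))
    (isCompact_Icc.image hσ).isClosed (isCompact_Icc.image hσ).isClosed
    (by
      intro w hw
      have := hGf hw
      rw [← hbdry] at this
      obtain ⟨x, _, hx⟩ := this
      have hm := toIcoMod_mem_Ico hL s x
      have e : σ (toIcoMod hL s x) = w := by
        rw [← hx, toIcoMod]; exact hper.sub_zsmul_eq _
      rcases le_total (toIcoMod hL s x) s' with h | h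
      · exact Or.inl ⟨_, ⟨hm.1, h⟩, e⟩
      · exact Or.inr ⟨_, ⟨h, hm.2.le⟩, e⟩)
    ⟨_, hq, t2, ⟨h2.le, h3.le⟩, rfl⟩
    ⟨_, hp, t1 + L, ⟨h4.le, by linarith⟩, hper t1⟩
  rcases eq_or_lt_of_le hb.2 with h | h
  · left; rw [h, hper] at hbw; rwa [hbw]
  · right
    have := cvx_per_inj L hL σ hper hinj a b (by rw [haw, hbw]) (by linarith [ha.2, hb.1])
      (by linarith [ha.1])
    have : b = s' := by linarith [ha.2, hb.1]
    rw [← this, hbw]; exact hwG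

set_option maxHeartbeats 1600000 in
theorem convex_only_inessential (r L : ℝ) (hr : 0 < r) (hL : 0 < L)
    (σ v : ℝ → EuclideanSpace ℝ (Fin 2))
    (hper : Function.Periodic σ L) (hvper : Function.Periodic v L)
    (hderiv : ∀ t, HasDerivAt σ (v t) t)
    (hunit : ∀ t, ‖v t‖ = 1)
    (hcont : Continuous v)
    (hlip : ∀ s t : ℝ, ‖v s - v t‖ ≤ (1 / r) * |s - t|)
    (hinj : Set.InjOn σ (Set.Ico 0 L))
    (K : Set (EuclideanSpace ℝ (Fin 2)))
    (hK : IsCompact K) (hconv : Convex ℝ K) (hint : (interior K).Nonempty)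
    (hbdry : σ '' Set.Ico 0 L = frontier K) :
    ∀ t1 t2 : ℝ, t1 < t2 → t2 < t1 + L →
      0 < dist (σ t1) (σ t2) → dist (σ t1) (σ t2) < 2 * r →
      (∀ x ∈ Set.Icc t1 t2, ∀ c : EuclideanSpace ℝ (Fin 2),
          dist (σ t1) c = r → dist (σ t2) c = r → σ x ∈ Metric.closedBall c r) ∨
      (∀ x ∈ Set.Icc t2 (t1 + L), ∀ c : EuclideanSpace ℝ (Fin 2),
          dist (σ t2) c = r → dist (σ t1) c = r → σ x ∈ Metric.closedBall c r) := by
  intro t1 t2 ht12 ht2L hd0 hdr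
  by_contra hcon
  push Not at hcon
  obtain ⟨⟨s, hs, c, hpc, hqc, hxc⟩, ⟨s', hs', c', hqc', hpc', hyc⟩⟩ := hcon
  have hcl := hK.isClosed
  have hσ : Continuous σ := continuous_iff_continuousAt.2 fun t => (hderiv t).continuousAt
  have hf := cvx_mem_frontier L hL σ hper K hbdry
  have fK : frontier K ⊆ K := hcl.frontier_subset
  have inj := cvx_per_inj L hL σ hper hinj
  -- the violating parameters are strictly inside the arcs
  have hs1 : t1 < s := lt_of_le_of_ne hs.1 (by
    rintro rfl; exact hxc (Metric.mem_closedBall.2 hpc.le))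
  have hs2 : s < t2 := lt_of_le_of_ne hs.2 (by
    rintro rfl; exact hxc (Metric.mem_closedBall.2 hqc.le))
  have hs1' : t2 < s' := lt_of_le_of_ne hs'.1 (by
    rintro rfl; exact hyc (Metric.mem_closedBall.2 hqc'.le))
  have hs2' : s' < t1 + L := lt_of_le_of_ne hs'.2 (by
    rintro rfl; rw [hper] at hyc; exact hyc (Metric.mem_closedBall.2 hpc'.le))
  obtain ⟨p, hp⟩ : ∃ p, p = σ t1 := ⟨_, rfl⟩
  obtain ⟨q, hq⟩ : ∃ q, q = σ t2 := ⟨_, rfl⟩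
  rw [← hp, ← hq] at hd0 hdr
  rw [← hp] at hpc hpc'
  rw [← hq] at hqc hqc'
  have hpf : p ∈ frontier K := hp ▸ hf t1
  have hqf : q ∈ frontier K := hq ▸ hf t2
  obtain ⟨u0, hu0⟩ : ∃ u0, u0 = q 0 - p 0 := ⟨_, rfl⟩
  obtain ⟨u1, hu1⟩ : ∃ u1, u1 = q 1 - p 1 := ⟨_, rfl⟩
  obtain ⟨D, hD⟩ : ∃ D, D = u0 ^ 2 + u1 ^ 2 := ⟨_, rfl⟩
  have hDd : dist p q ^ 2 = D := by rw [cvx_dist_sq, hD, hu0, hu1]; ring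
  have hDpos : 0 < D := by rw [← hDd]; positivity
  have hD4 : D < 4 * r ^ 2 := by rw [← hDd]; nlinarith
  have hn : 0 < (-u1) ^ 2 + u0 ^ 2 := by rw [neg_sq]; linarith
  have hn' : 0 < u1 ^ 2 + (-u0) ^ 2 := by rw [neg_sq]; linarith
  obtain ⟨g0, hg0⟩ : ∃ g0, g0 = -u1 * p 0 + u0 * p 1 := ⟨_, rfl⟩
  have gq : -u1 * q 0 + u0 * q 1 = g0 := by rw [hg0, hu0, hu1]; ring
  by_cases hA : (∀ y ∈ K, g0 ≤ -u1 * y 0 + u0 * y 1) ∨ (∀ y ∈ K, -u1 * y 0 + u0 * y 1 ≤ g0)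
  · -- the line is a support line: the segment lies in the boundary
    have hseg : segment ℝ p q ⊆ frontier K := by
      intro y hy
      have hyK : y ∈ K := hconv.segment_subset (fK hpf) (fK hqf) hy
      refine ⟨subset_closure hyK, ?_⟩
      intro hyi
      have gy : -u1 * y 0 + u0 * y 1 = g0 := by
        obtain ⟨a, b, _, _, hab, rfl⟩ := hy
        simp only [PiLp.add_apply, PiLp.smul_apply, smul_eq_mul]
        linear_combination -a * hg0 + b * gq + g0 * hab
      rcases hA with h | h
      · obtain ⟨w, hw, hw2⟩ := cvx_noint K (-u1) u0 hn y hyi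
        linarith [h w hw]
      · obtain ⟨w, hw, hw2⟩ := cvx_noint K u1 (-u0) hn' y hyi
        linarith [h w hw]
    rcases cvx_separate L hL σ hper hσ hinj K hbdry t1 t2 s s' hs1 hs2 hs1' hs2' (segment ℝ p q)
      (convex_segment p q).isPreconnected hseg (hp ▸ left_mem_segment ℝ p q)
      (hq ▸ right_mem_segment ℝ p q) with h | h
    · exact hxc ((convex_closedBall c r).segment_subset (Metric.mem_closedBall.2 hpc.le)
        (Metric.mem_closedBall.2 hqc.le) h)
    · exact hyc ((convex_closedBall c' r).segment_subset (Metric.mem_closedBall.2 hpc'.le)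
        (Metric.mem_closedBall.2 hqc'.le) h)
  -- the line crosses the interior
  obtain ⟨T, hT⟩ : ∃ T : EuclideanSpace ℝ (Fin 2) → ℝ, ∀ y, D * (T y + 1 / 2) =
      u0 * (y 0 - p 0) + u1 * (y 1 - p 1) :=
    ⟨fun y => (u0 * (y 0 - p 0) + u1 * (y 1 - p 1)) / D - 1 / 2, fun y => by field_simp; ring⟩
  obtain ⟨N, hN⟩ : ∃ N : EuclideanSpace ℝ (Fin 2) → ℝ, ∀ y, D * N y = -u1 * y 0 + u0 * y 1 - g0 :=
    ⟨fun y => (-u1 * y 0 + u0 * y 1 - g0) / D, fun y => by field_simp⟩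
  have hTN : ∀ y z, dist y z ^ 2 = D * ((T y - T z) ^ 2 + (N y - N z) ^ 2) := by
    intro y z
    apply mul_left_cancel₀ hDpos.ne'
    rw [cvx_dist_sq]
    have e1 : D * (T y - T z) = u0 * (y 0 - z 0) + u1 * (y 1 - z 1) := by
      linear_combination hT y - hT z
    have e2 : D * (N y - N z) = -u1 * (y 0 - z 0) + u0 * (y 1 - z 1) := by
      linear_combination hN y - hN z
    have : D * (D * ((T y - T z) ^ 2 + (N y - N z) ^ 2)) =
      (D * (T y - T z)) ^ 2 + (D * (N y - N z)) ^ 2 := by ring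
    rw [this, e1, e2, hD]; ring
  have hNp : N p = 0 := by
    have := hN p
    rw [hg0] at this
    have h : D * N p = 0 := by linarith
    exact (mul_eq_zero.1 h).resolve_left hDpos.ne'
  have hNq : N q = 0 := by
    have h : D * N q = 0 := by linarith [hN q]
    exact (mul_eq_zero.1 h).resolve_left hDpos.ne'
  have hTp : T p = -(1 / 2) := by
    have h : D * (T p + 1 / 2) = 0 := by linarith [hT p]
    linarith [(mul_eq_zero.1 h).resolve_left hDpos.ne']
  have hTq : T q = 1 / 2 := by
    have h : D * (T q - 1 / 2) = 0 := by
      have := hT q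
      rw [← hu0, ← hu1] at this
      linear_combination this - hD
    linarith [(mul_eq_zero.1 h).resolve_left hDpos.ne']
  have hline : ∀ y ∈ K, N y = 0 → -(1 / 2) ≤ T y ∧ T y ≤ 1 / 2 := by
    intro y hy hNy
    have gy : -u1 * y 0 + u0 * y 1 = g0 := by have := hN y; rw [hNy] at this; linarith
    constructor
    · by_contra hc; push Not at hc
      apply hA
      refine cvx_mid K hconv hint q p y hpf (fK hqf) hy (-u1) u0 g0 gq hg0.symm gy ?_ ?_
      · have := hT q; rw [hTq] at this; linarith
      · have h1 := hT y; have h2 := mul_pos hDpos (by linarith : 0 < -(T y + 1 / 2)); linarith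
    · by_contra hc; push Not at hc
      apply hA
      refine cvx_mid K hconv hint y q p hqf hy (fK hpf) (-u1) u0 g0 gy gq hg0.symm ?_ ?_
      · have h1 := hT y; have h3 := hT q; rw [hTq] at h3
        have h2 := mul_pos hDpos (by linarith : 0 < T y - 1 / 2); linarith
      · have := hT q; rw [hTq] at this; linarith
  obtain ⟨k, hk⟩ : ∃ k, D * k = r ^ 2 := ⟨r ^ 2 / D, by field_simp⟩
  have hk4 : 1 / 4 < k := by
    by_contra hc; push Not at hc
    nlinarith
  have hball : ∀ z, Metric.closedBall z r ⊆ K → ∀ τ : ℝ, (τ - T z) ^ 2 + N z ^ 2 ≤ k →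
      -(1 / 2) ≤ τ ∧ τ ≤ 1 / 2 := by
    intro z hz τ hτ
    set y : EuclideanSpace ℝ (Fin 2) := !₂[p 0 + (τ + 1 / 2) * u0, p 1 + (τ + 1 / 2) * u1] with hy
    have y0 : y 0 = p 0 + (τ + 1 / 2) * u0 := rfl
    have y1 : y 1 = p 1 + (τ + 1 / 2) * u1 := rfl
    have hTy : T y = τ := by
      apply mul_left_cancel₀ hDpos.ne'
      have := hT y; rw [y0, y1] at this
      linear_combination this - (τ + 1 / 2) * hD
    have hNy : N y = 0 := by
      apply mul_left_cancel₀ hDpos.ne'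
      have := hN y; rw [y0, y1] at this
      linear_combination this - hg0
    have hyK : y ∈ K := by
      apply hz
      rw [Metric.mem_closedBall]
      apply (abs_le_of_sq_le_sq' _ hr.le).2
      rw [hTN, hTy, hNy, ← hk]
      apply mul_le_mul_of_nonneg_left _ hDpos.le
      nlinarith
    have := hline y hyK hNy
    rwa [hTy] at this
  have hcen : ∀ c, dist p c = r → dist q c = r → T c = 0 ∧ 1 / 4 + N c ^ 2 = k := by
    intro c h1 h2
    have e1 := hTN p c
    have e2 := hTN q c
    rw [h1, hTp, hNp, ← hk] at e1
    rw [h2, hTq, hNq, ← hk] at e2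
    have e1' := mul_left_cancel₀ hDpos.ne' e1
    have e2' := mul_left_cancel₀ hDpos.ne' e2
    have : T c = 0 := by linarith
    refine ⟨this, ?_⟩
    rw [this] at e1'
    linarith
  have roll := cvx_rolling r L hr hL σ v hper hvper hderiv hunit hcont hlip hinj K hcl hconv hint hbdry
  have hout : ∀ c x, dist p c = r → dist q c = r → x ∉ Metric.closedBall c r →
      k < T x ^ 2 + (N x - N c) ^ 2 := by
    intro c x h1 h2 hx
    rw [Metric.mem_closedBall, not_le] at hx
    have h3 := hTN x c
    rw [(hcen c h1 h2).1, sub_zero] at h3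
    have h4 : r ^ 2 < dist x c ^ 2 := by nlinarith
    rw [h3, ← hk] at h4
    exact lt_of_mul_lt_mul_left h4 hDpos.le
  have hin : ∀ x z, dist x z ≤ r → (T x - T z) ^ 2 + (N x - N z) ^ 2 ≤ k := by
    intro x z h
    have h4 := pow_le_pow_left₀ dist_nonneg h 2
    rw [hTN, ← hk] at h4
    exact le_of_mul_le_mul_left h4 hDpos
  have upper : ∀ t c, dist p c = r → dist q c = r → σ t ∉ Metric.closedBall c r → 0 < N (σ t) →
      ∃ z, Metric.closedBall z r ⊆ K ∧ 0 < N z := by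
    intro t c h1 h2 h3 h4
    obtain ⟨z, hz, hxz⟩ := roll t
    exact ⟨z, hz, cvx_scalar k (T z) (N z) (T (σ t)) (N (σ t)) (N c) (hball z hz) (hin _ _ hxz)
      (hcen c h1 h2).2 (hout c _ h1 h2 h3) h4⟩
  have lower : ∀ t c, dist p c = r → dist q c = r → σ t ∉ Metric.closedBall c r → N (σ t) < 0 →
      ∃ z, Metric.closedBall z r ⊆ K ∧ N z < 0 := by
    intro t c h1 h2 h3 h4
    obtain ⟨z, hz, hxz⟩ := roll t
    refine ⟨z, hz, ?_⟩
    have := cvx_scalar k (T z) (-N z) (T (σ t)) (-N (σ t)) (-N c)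
      (by intro τ h; rw [neg_sq] at h; exact hball z hz τ h)
      (by have := hin _ _ hxz; nlinarith) (by rw [neg_sq]; exact (hcen c h1 h2).2)
      (by have := hout c _ h1 h2 h3; nlinarith) (by linarith)
    linarith
  have contra : ∀ z w, Metric.closedBall z r ⊆ K → Metric.closedBall w r ⊆ K → 0 < N z → N w < 0 →
      False := by
    intro z w hz hw hNz hNw
    obtain ⟨a, ha⟩ : ∃ a, a * (N z - N w) = - N w :=
      ⟨-N w / (N z - N w), div_mul_cancel₀ _ (by linarith)⟩
    have ha0 : 0 ≤ a := by by_contra hc; push Not at hc; nlinarith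
    have ha1 : 0 ≤ 1 - a := by by_contra hc; push Not at hc; nlinarith
    have hzw : Metric.closedBall (a • z + (1 - a) • w) r ⊆ K := by
      intro y hy
      rw [Metric.mem_closedBall, dist_eq_norm] at hy
      set e := y - (a • z + (1 - a) • w) with he
      have h1 : z + e ∈ K := hz (by simpa [Metric.mem_closedBall, dist_eq_norm] using hy)
      have h2 : w + e ∈ K := hw (by simpa [Metric.mem_closedBall, dist_eq_norm] using hy)
      have := hconv h1 h2 ha0 ha1 (by ring)
      have e2 : a • (z + e) + (1 - a) • (w + e) = y := by
        have : y = e + (a • z + (1 - a) • w) := by rw [he]; abel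
        rw [this]; module
      rwa [e2] at this
    have hN0 : N (a • z + (1 - a) • w) = 0 := by
      apply mul_left_cancel₀ hDpos.ne'
      have h := hN (a • z + (1 - a) • w)
      simp only [PiLp.add_apply, PiLp.smul_apply, smul_eq_mul] at h
      linear_combination h - a * hN z - (1 - a) * hN w + D * ha
    have hb := hball _ hzw
    rw [hN0] at hb
    have hk0 : 0 ≤ k := by linarith
    have hs2 := Real.sq_sqrt hk0
    have b1 := (hb (T (a • z + (1 - a) • w) + Real.sqrt k) (by nlinarith)).2
    have b2 := (hb (T (a • z + (1 - a) • w) - Real.sqrt k) (by nlinarith)).1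
    have : Real.sqrt k ≤ 1 / 2 := by linarith
    nlinarith [Real.sqrt_nonneg k]
  -- sides
  have hNcont : Continuous fun t => N (σ t) := by
    have : (fun t => N (σ t)) = fun t => (-u1 * σ t 0 + u0 * σ t 1 - g0) / D := by
      ext t; rw [← hN]; field_simp
    rw [this]; fun_prop
  have hNne : ∀ t, (t ∈ Set.Ioo t1 t2 ∨ t ∈ Set.Ioo t2 (t1 + L)) → N (σ t) ≠ 0 := by
    intro t ht h
    apply hA
    have gt : -u1 * σ t 0 + u0 * σ t 1 = g0 := by have := hN (σ t); rw [h] at this; linarith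
    refine cvx_three K hconv hcl hint p q (σ t) hpf hqf (hf t) (dist_pos.1 hd0) ?_ ?_ (-u1) u0 g0 hn
      hg0.symm gq gt
    · rw [hp]; intro h
      rcases ht with ht | ht
      · have := inj t1 t h (by linarith [ht.1, ht.2]) (by linarith [ht.1, ht.2]); linarith [ht.1, ht.2]
      · have := inj t1 t h (by linarith [ht.1, ht.2]) (by linarith [ht.1, ht.2]); linarith [ht.1, ht.2]
    · rw [hq]; intro h
      rcases ht with ht | ht
      · have := inj t2 t h (by linarith [ht.1, ht.2]) (by linarith [ht.1, ht.2]); linarith [ht.1, ht.2]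
      · have := inj t2 t h (by linarith [ht.1, ht.2]) (by linarith [ht.1, ht.2]); linarith [ht.1, ht.2]
  have sg1 := cvx_sign _ hNcont t1 t2 (fun t ht => hNne t (Or.inl ht))
  have sg2 := cvx_sign _ hNcont t2 (t1 + L) (fun t ht => hNne t (Or.inr ht))
  have cover : ∀ P : ℝ → Prop, P 0 → (∀ t ∈ Set.Ioo t1 t2, P (N (σ t))) →
      (∀ t ∈ Set.Ioo t2 (t1 + L), P (N (σ t))) → ∀ y ∈ frontier K, P (N y) := by
    intro P h0 h1 h2 y hy
    rw [← hbdry] at hy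
    obtain ⟨x, _, hx⟩ := hy
    have hm := toIcoMod_mem_Ico hL t1 x
    have e : σ (toIcoMod hL t1 x) = y := by
      rw [← hx, toIcoMod]; exact hper.sub_zsmul_eq _
    rw [← e]
    rcases eq_or_lt_of_le hm.1 with h | h
    · rw [← h, ← hp, hNp]; exact h0
    · rcases lt_trichotomy (toIcoMod hL t1 x) t2 with h' | h' | h'
      · exact h1 _ ⟨h, h'⟩
      · rw [h', ← hq, hNq]; exact h0
      · exact h2 _ ⟨h', hm.2⟩
  have hKne : K.Nonempty := ⟨p, fK hpf⟩
  rcases sg1 with a1 | a1 <;> rcases sg2 with a2 | a2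
  · apply hA; left
    have hfr := cover (fun x => 0 ≤ x) le_rfl (fun t ht => (a1 t ht).le) (fun t ht => (a2 t ht).le)
    obtain ⟨m, hm, hmin⟩ := hK.exists_isMinOn hKne
      (f := fun y : EuclideanSpace ℝ (Fin 2) => -u1 * y 0 + u0 * y 1) (by fun_prop)
    have hmf : m ∈ frontier K := ⟨subset_closure hm, fun hmi => by
      obtain ⟨w, hw, hw2⟩ := cvx_noint K (-u1) u0 hn m hmi
      have : -u1 * m 0 + u0 * m 1 ≤ -u1 * w 0 + u0 * w 1 := hmin hw
      linarith⟩
    intro y hy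
    have h1 : -u1 * m 0 + u0 * m 1 ≤ -u1 * y 0 + u0 * y 1 := hmin hy
    have h2 := mul_nonneg hDpos.le (hfr m hmf)
    rw [hN] at h2
    linarith
  · obtain ⟨z, hz, hz'⟩ := upper s c hpc hqc hxc (a1 s ⟨hs1, hs2⟩)
    obtain ⟨w, hw, hw'⟩ := lower s' c' hpc' hqc' hyc (a2 s' ⟨hs1', hs2'⟩)
    exact contra z w hz hw hz' hw'
  · obtain ⟨w, hw, hw'⟩ := lower s c hpc hqc hxc (a1 s ⟨hs1, hs2⟩)
    obtain ⟨z, hz, hz'⟩ := upper s' c' hpc' hqc' hyc (a2 s' ⟨hs1', hs2'⟩)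
    exact contra z w hz hw hz' hw'
  · apply hA; right
    have hfr := cover (fun x => x ≤ 0) le_rfl (fun t ht => (a1 t ht).le) (fun t ht => (a2 t ht).le)
    obtain ⟨m, hm, hmax⟩ := hK.exists_isMaxOn hKne
      (f := fun y : EuclideanSpace ℝ (Fin 2) => -u1 * y 0 + u0 * y 1) (by fun_prop)
    have hmf : m ∈ frontier K := ⟨subset_closure hm, fun hmi => by
      obtain ⟨w, hw, hw2⟩ := cvx_noint K u1 (-u0) hn' m hmi
      have : -u1 * w 0 + u0 * w 1 ≤ -u1 * m 0 + u0 * m 1 := hmax hw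
      linarith⟩
    intro y hy
    have h1 : -u1 * y 0 + u0 * y 1 ≤ -u1 * m 0 + u0 * m 1 := hmax hy
    have h2 := mul_nonneg hDpos.le (neg_nonneg.2 (hfr m hmf))
    have h3 := hN m
    linarith
end
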